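/- arXiv:2605.24638 — 6 statements merged into one kernel-verified Lean document; each statement's English description precedes it below -/
import Mathlib

section
/- Let k ≥ 4 be an even integer, let V be a real vector space with basis e₁, …, e_k, and for each pair of indices i, j ∈ {1,…,k} let Ω_{ij} : V × V → ℝ be an alternating bilinear map. Suppose that for all indices i, j, p, q and all X₁, X₂, X₃, X₄ ∈ V: Σ_{ρ ∈ S₄} sgn(ρ) Ω_{ij}(X_{ρ(1)}, X_{ρ(2)}) Ω_{pq}(X_{ρ(3)}, X_{ρ(4)}) = 0. Then the Pfaffian sum vanishes: Σ_{σ, τ ∈ S_k} sgn(σ) sgn(τ) ∏_{t=1}^{k/2} Ω_{σ(2t−1) σ(2t)}(e_{τ(2t−1)}, e_{τ(2t)}) = 0. -/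
/-- If all pairwise wedge products of the 2-forms `Ω_{ij}` vanish, then for even `k ≥ 4`
the Pfaffian sum of the family `(Ω_{ij})` evaluated on a basis vanishes. -/
theorem stmt_5 {V : Type*} [AddCommGroup V] [Module ℝ V]
    (k : ℕ) (hk : 4 ≤ k) (hke : Even k)
    (b : Module.Basis (Fin k) ℝ V)
    (Ω : Fin k → Fin k → V →ₗ[ℝ] V →ₗ[ℝ] ℝ)
    (halt : ∀ (i j : Fin k) (X : V), Ω i j X X = 0)
    (hwedge : ∀ (i j p q : Fin k) (X : Fin 4 → V),
      ∑ ρ : Equiv.Perm (Fin 4), ((Equiv.Perm.sign ρ : ℤ) : ℝ) *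
        (Ω i j (X (ρ 0)) (X (ρ 1)) * Ω p q (X (ρ 2)) (X (ρ 3))) = 0) :
    ∑ σ : Equiv.Perm (Fin k), ∑ τ : Equiv.Perm (Fin k),
      ((Equiv.Perm.sign σ : ℤ) : ℝ) * ((Equiv.Perm.sign τ : ℤ) : ℝ) *
        ∏ t : Fin (k / 2),
          Ω (σ ⟨2 * t, by have := t.isLt; omega⟩)
            (σ ⟨2 * t + 1, by have := t.isLt; omega⟩)
            (b (τ ⟨2 * t, by have := t.isLt; omega⟩))
            (b (τ ⟨2 * t + 1, by have := t.isLt; omega⟩)) = 0 := by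
  classical
  refine Finset.sum_eq_zero fun σ _ => ?_
  let e : Fin 4 ↪ Fin k := Fin.castLEEmb hk
  let ι : Equiv.Perm (Fin 4) → Equiv.Perm (Fin k) := fun ρ => ρ.viaFintypeEmbedding e
  have hsign : ∀ ρ, Equiv.Perm.sign (ι ρ) = Equiv.Perm.sign ρ := fun ρ =>
    Equiv.Perm.viaFintypeEmbedding_sign ρ e
  have himg : ∀ ρ (i : Fin 4), ι ρ (e i) = e (ρ i) := fun ρ i =>
    Equiv.Perm.viaFintypeEmbedding_apply_image ρ e i
  have hout : ∀ ρ (j : Fin k), 4 ≤ j.val → ι ρ j = j := by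
    intro ρ j hj
    apply Equiv.Perm.viaFintypeEmbedding_apply_notMem_range
    rintro ⟨i, rfl⟩
    have h1 : (e i).val = i.val := rfl
    have h2 := i.isLt
    omega
  let G : Equiv.Perm (Fin k) → Fin (k / 2) → ℝ := fun τ t =>
    Ω (σ ⟨2 * t, by have := t.isLt; omega⟩)
      (σ ⟨2 * t + 1, by have := t.isLt; omega⟩)
      (b (τ ⟨2 * t, by have := t.isLt; omega⟩))
      (b (τ ⟨2 * t + 1, by have := t.isLt; omega⟩))
  let f : Equiv.Perm (Fin k) → ℝ := fun τ =>
    ((Equiv.Perm.sign σ : ℤ) : ℝ) * ((Equiv.Perm.sign τ : ℤ) : ℝ) * ∏ t, G τ t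
  change ∑ τ, f τ = 0
  let t0 : Fin (k / 2) := ⟨0, by omega⟩
  let t1 : Fin (k / 2) := ⟨1, by omega⟩
  have h10 : t1 ∈ Finset.univ.erase t0 := by simp [t0, t1]
  have hsplit : ∀ τ, ∏ t, G τ t =
      G τ t0 * (G τ t1 * ∏ t ∈ (Finset.univ.erase t0).erase t1, G τ t) := by
    intro τ
    rw [Finset.mul_prod_erase _ _ h10, Finset.mul_prod_erase _ _ (Finset.mem_univ _)]
  have hrest : ∀ τ ρ, ∏ t ∈ (Finset.univ.erase t0).erase t1, G (τ * ι ρ) t =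
      ∏ t ∈ (Finset.univ.erase t0).erase t1, G τ t := by
    intro τ ρ
    refine Finset.prod_congr rfl fun t ht => ?_
    have ht2 : 2 ≤ t.val := by
      simp only [Finset.mem_erase, Finset.mem_univ, and_true, ne_eq, Fin.ext_iff, t0, t1] at ht
      omega
    simp only [G, Equiv.Perm.mul_apply]
    rw [hout ρ ⟨2 * t, _⟩ (by simp only; omega), hout ρ ⟨2 * t + 1, _⟩ (by simp only; omega)]
  have hG0 : ∀ τ ρ, G (τ * ι ρ) t0 = Ω (σ (e 0)) (σ (e 1)) (b (τ (e (ρ 0)))) (b (τ (e (ρ 1)))) := by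
    intro τ ρ
    rw [← himg, ← himg]
    rfl
  have hG1 : ∀ τ ρ, G (τ * ι ρ) t1 = Ω (σ (e 2)) (σ (e 3)) (b (τ (e (ρ 2)))) (b (τ (e (ρ 3)))) := by
    intro τ ρ
    rw [← himg, ← himg]
    rfl
  have hzero : ∀ τ, ∑ ρ, f (τ * ι ρ) = 0 := by
    intro τ
    have hw := hwedge (σ (e 0)) (σ (e 1)) (σ (e 2)) (σ (e 3)) (fun i => b (τ (e i)))
    have : ∀ ρ, f (τ * ι ρ) = (((Equiv.Perm.sign σ : ℤ) : ℝ) * ((Equiv.Perm.sign τ : ℤ) : ℝ) *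
        ∏ t ∈ (Finset.univ.erase t0).erase t1, G τ t) * (((Equiv.Perm.sign ρ : ℤ) : ℝ) *
        (Ω (σ (e 0)) (σ (e 1)) (b (τ (e (ρ 0)))) (b (τ (e (ρ 1)))) *
         Ω (σ (e 2)) (σ (e 3)) (b (τ (e (ρ 2)))) (b (τ (e (ρ 3)))))) := by
      intro ρ
      simp only [f]
      rw [hsplit, hrest, hG0, hG1, Equiv.Perm.sign_mul, hsign]
      push_cast
      ring
    rw [Finset.sum_congr rfl fun ρ _ => this ρ, ← Finset.mul_sum, hw, mul_zero]
  have hsum : ∀ ρ, ∑ τ, f (τ * ι ρ) = ∑ τ, f τ := fun ρ =>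
    Equiv.sum_comp (Equiv.mulRight (ι ρ)) f
  have h24 : ∑ ρ : Equiv.Perm (Fin 4), ∑ τ, f (τ * ι ρ) = 0 := by
    rw [Finset.sum_comm]
    exact Finset.sum_eq_zero fun τ _ => hzero τ
  rw [Finset.sum_congr rfl fun ρ _ => hsum ρ, Finset.sum_const, nsmul_eq_mul] at h24
  refine (mul_eq_zero.mp h24).resolve_left ?_
  simp [Finset.card_univ, Fintype.card_perm, Nat.factorial_ne_zero]
end

section
/- Let k ≥ 2 be an even integer, let V be a real vector space with basis e₁, …, e_k and dual basis θ₁, …, θ_k, and let κ₁, …, κ_k be real numbers. Define D_{ij}(X,Y) := κ_i κ_j (θ_i(X) θ_j(Y) − θ_j(X) θ_i(Y)) for i, j ∈ {1,…,k}. Then Σ_{σ, τ ∈ S_k} sgn(σ) sgn(τ) ∏_{t=1}^{k/2} D_{σ(2t−1) σ(2t)}(e_{τ(2t−1)}, e_{τ(2t)}) = 2^{k/2} · k! · ∏_{ℓ=1}^{k} κ_ℓ. -/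
/-- The signed sum over permutations of `ι × Fin 2` of products of `2 × 2` minors. -/
theorem core_sum (ι : Type*) [Fintype ι] [DecidableEq ι] :
    ∑ ρ : Equiv.Perm (ι × Fin 2), ((Equiv.Perm.sign ρ : ℤ) : ℝ) *
      ∏ t : ι, ((if ρ (t, 0) = (t, 0) then (1 : ℝ) else 0) *
          (if ρ (t, 1) = (t, 1) then (1 : ℝ) else 0) -
        (if ρ (t, 0) = (t, 1) then (1 : ℝ) else 0) *
          (if ρ (t, 1) = (t, 0) then (1 : ℝ) else 0)) = 2 ^ Fintype.card ι := by
  have h1 : ∀ (ρ : Equiv.Perm (ι × Fin 2)) (t : ι),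
      ((if ρ (t, 0) = (t, 0) then (1 : ℝ) else 0) *
          (if ρ (t, 1) = (t, 1) then (1 : ℝ) else 0) -
        (if ρ (t, 0) = (t, 1) then (1 : ℝ) else 0) *
          (if ρ (t, 1) = (t, 0) then (1 : ℝ) else 0)) =
      ∑ s : Equiv.Perm (Fin 2), ((Equiv.Perm.sign s : ℤ) : ℝ) *
        ∏ i, (if ρ (t, i) = (t, s i) then (1 : ℝ) else 0) := by
    intro ρ t
    have hu : (Finset.univ : Finset (Equiv.Perm (Fin 2))) = {1, Equiv.swap 0 1} := by decide
    have hne : (1 : Equiv.Perm (Fin 2)) ≠ Equiv.swap 0 1 := by decide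
    rw [hu, Finset.sum_pair hne]
    simp only [Fin.prod_univ_two, Equiv.Perm.sign_one, Equiv.Perm.sign_swap (zero_ne_one (α := Fin 2)),
      Equiv.Perm.one_apply, Equiv.swap_apply_left, Equiv.swap_apply_right]
    split_ifs <;> simp only [*, if_true, if_false] <;> norm_num
  have h2 : ∀ (ρ : Equiv.Perm (ι × Fin 2)) (s : ι → Equiv.Perm (Fin 2)),
      (∏ t, ∏ i, (if ρ (t, i) = (t, s t i) then (1 : ℝ) else 0)) =
        if ρ = Equiv.prodCongrRight s then 1 else 0 := by
    intro ρ s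
    simp only [Finset.prod_ite_zero, Finset.prod_const_one]
    congr 1
    simp only [Finset.mem_univ, true_imp_iff, eq_iff_iff, Equiv.ext_iff, Prod.forall]
    rfl
  simp only [h1, Finset.prod_univ_sum, Fintype.piFinset_univ, Finset.prod_mul_distrib, h2,
    Finset.mul_sum]
  rw [Finset.sum_comm]
  simp only [mul_ite, mul_one, mul_zero, Finset.sum_ite_eq', Finset.mem_univ, if_true,
    Finset.sum_ite_eq, Equiv.Perm.sign_prodCongrRight]
  have h3 : ∀ s : ι → Equiv.Perm (Fin 2),
      (((∏ t, Equiv.Perm.sign (s t) : ℤˣ) : ℤ) : ℝ) *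
        ∏ t, ((Equiv.Perm.sign (s t) : ℤ) : ℝ) = 1 := by
    intro s
    push_cast
    rw [← Finset.prod_mul_distrib]
    refine Finset.prod_eq_one fun t _ => ?_
    rw [← Int.cast_mul, ← Units.val_mul, Int.units_mul_self]
    simp
  simp only [h3]
  simp [Fintype.card_perm]

/-- The Pfaffian sum of the family of 2-forms `D_{ij} = κ_i κ_j θ_i ∧ θ_j` coming from a
diagonalized second fundamental form, evaluated on the basis, equals
`2^(k/2) · k! · ∏ κ_ℓ`. -/
theorem stmt_6 {V : Type*} [AddCommGroup V] [Module ℝ V]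
    (k : ℕ) (hk : 2 ≤ k) (hke : Even k)
    (b : Module.Basis (Fin k) ℝ V) (κ : Fin k → ℝ) :
    ∑ σ : Equiv.Perm (Fin k), ∑ τ : Equiv.Perm (Fin k),
      ((Equiv.Perm.sign σ : ℤ) : ℝ) * ((Equiv.Perm.sign τ : ℤ) : ℝ) *
        ∏ t : Fin (k / 2),
          (κ (σ ⟨2 * t, by have := t.isLt; omega⟩) *
            κ (σ ⟨2 * t + 1, by have := t.isLt; omega⟩) *
            (b.coord (σ ⟨2 * t, by have := t.isLt; omega⟩)
                (b (τ ⟨2 * t, by have := t.isLt; omega⟩)) *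
              b.coord (σ ⟨2 * t + 1, by have := t.isLt; omega⟩)
                (b (τ ⟨2 * t + 1, by have := t.isLt; omega⟩)) -
              b.coord (σ ⟨2 * t + 1, by have := t.isLt; omega⟩)
                (b (τ ⟨2 * t, by have := t.isLt; omega⟩)) *
              b.coord (σ ⟨2 * t, by have := t.isLt; omega⟩)
                (b (τ ⟨2 * t + 1, by have := t.isLt; omega⟩)))) =
      2 ^ (k / 2) * (Nat.factorial k : ℝ) * ∏ ℓ : Fin k, κ ℓ := by
  classical
  have hkk : k / 2 * 2 = k := Nat.div_mul_cancel hke.two_dvd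
  let e : Fin (k / 2) × Fin 2 ≃ Fin k := finProdFinEquiv.trans (finCongr hkk)
  have e0 : ∀ (t : Fin (k / 2)) (h : 2 * (t : ℕ) < k), (⟨2 * t, h⟩ : Fin k) = e (t, 0) := by
    intro t h; ext; simp [e]
  have e1 : ∀ (t : Fin (k / 2)) (h : 2 * (t : ℕ) + 1 < k),
      (⟨2 * t + 1, h⟩ : Fin k) = e (t, 1) := by
    intro t h; ext; simp [e]; omega
  simp only [e0, e1]
  have hκ : ∀ σ : Equiv.Perm (Fin k),
      ∏ t : Fin (k / 2), (κ (σ (e (t, 0))) * κ (σ (e (t, 1)))) = ∏ ℓ, κ ℓ := by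
    intro σ
    rw [← Equiv.prod_comp (e.trans σ) κ, Fintype.prod_prod_type]
    simp [Fin.prod_univ_two]
  have hσ : ∀ σ : Equiv.Perm (Fin k), (∑ τ : Equiv.Perm (Fin k),
      ((Equiv.Perm.sign σ : ℤ) : ℝ) * ((Equiv.Perm.sign τ : ℤ) : ℝ) *
        ∏ t : Fin (k / 2),
          (κ (σ (e (t, 0))) * κ (σ (e (t, 1))) *
            (b.coord (σ (e (t, 0))) (b (τ (e (t, 0)))) *
              b.coord (σ (e (t, 1))) (b (τ (e (t, 1)))) -
              b.coord (σ (e (t, 1))) (b (τ (e (t, 0)))) *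
              b.coord (σ (e (t, 0))) (b (τ (e (t, 1))))))) =
      2 ^ (k / 2) * ∏ ℓ, κ ℓ := by
    intro σ
    have hc := core_sum (Fin (k / 2))
    rw [Fintype.card_fin] at hc
    rw [← hc, Finset.sum_mul, ← Equiv.sum_comp (e.permCongr.trans (Equiv.mulLeft σ))]
    refine Finset.sum_congr rfl fun ρ _ => ?_
    rw [Finset.prod_mul_distrib, hκ σ]
    have hs : ((Equiv.Perm.sign σ : ℤ) : ℝ) *
        ((Equiv.Perm.sign ((e.permCongr.trans (Equiv.mulLeft σ)) ρ) : ℤ) : ℝ) =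
        ((Equiv.Perm.sign ρ : ℤ) : ℝ) := by
      simp only [Equiv.trans_apply, Equiv.coe_mulLeft, Equiv.Perm.sign_mul,
        Equiv.Perm.sign_permCongr]
      rw [← Int.cast_mul, ← Units.val_mul, ← mul_assoc, Int.units_mul_self, one_mul]
    rw [hs]
    have hd : ∀ x y, b.coord (σ (e x)) (b ((e.permCongr.trans (Equiv.mulLeft σ)) ρ (e y))) =
        if ρ y = x then (1 : ℝ) else 0 := by
      intro x y
      simp [Module.Basis.coord_apply, Finsupp.single_apply]
    simp only [hd]
    ring
  simp only [hσ]
  simp [Fintype.card_perm]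
  ring
end

section
/- Let k ≥ 2 be an even integer. There exists a constant c_k > 0, depending only on k, with the following property. Let V be a real vector space with basis e₁, …, e_k and dual basis θ₁, …, θ_k; let κ₁, …, κ_k be real numbers; and for i, j ∈ {1,…,k} let Ω_{ij} : V × V → ℝ be alternating bilinear maps with Ω_{ij} = −Ω_{ji}, such that for all indices i, j, p, q and all X₁, X₂, X₃, X₄ ∈ V: Σ_{ρ ∈ S₄} sgn(ρ) Ω_{ij}(X_{ρ(1)}, X_{ρ(2)}) Ω_{pq}(X_{ρ(3)}, X_{ρ(4)}) = 0. Define A_{ij}(X,Y) := Ω_{ij}(X,Y) + κ_i κ_j (θ_i(X) θ_j(Y) − θ_j(X) θ_i(Y)). Then Σ_{σ, τ ∈ S_k} sgn(σ) sgn(τ) ∏_{t=1}^{k/2} A_{σ(2t−1) σ(2t)}(e_{τ(2t−1)}, e_{τ(2t)}) = 2^{k/2} · k! · ∏_{ℓ=1}^{k} κ_ℓ + c_k · Σ_{1 ≤ i < j ≤ k} Ω_{ij}(e_i, e_j) · ∏_{ℓ ∉ {i,j}} κ_ℓ. -/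
universe u

/-- indicator that `τ` fixes both points of the pair `t`. -/
def pairFix {T ι : Type*} [DecidableEq ι] (a b : T → ι) (t : T) (τ : Equiv.Perm ι) : ℝ :=
  (if τ (a t) = a t then 1 else 0) * (if τ (b t) = b t then 1 else 0)

/-- the sign as a real number. -/
def rsgn {ι : Type*} [DecidableEq ι] [Fintype ι] (τ : Equiv.Perm ι) : ℝ :=
  ((Equiv.Perm.sign τ : ℤ) : ℝ)

lemma rsgn_mul {ι : Type*} [DecidableEq ι] [Fintype ι] (σ τ : Equiv.Perm ι) :
    rsgn (σ * τ) = rsgn σ * rsgn τ := by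
  simp [rsgn]

lemma rsgn_sq {ι : Type*} [DecidableEq ι] [Fintype ι] (σ : Equiv.Perm ι) :
    rsgn σ * rsgn σ = 1 := by
  unfold rsgn
  rcases Int.units_eq_one_or (Equiv.Perm.sign σ) with h | h <;> simp [h]

lemma rsgn_swap {ι : Type*} [DecidableEq ι] [Fintype ι] {x y : ι} (h : x ≠ y) :
    rsgn (Equiv.swap x y) = -1 := by
  simp [rsgn, Equiv.Perm.sign_swap h]

set_option linter.unusedSectionVars false
set_option linter.unusedSimpArgs false

section core
variable {T ι : Type*} [DecidableEq T] [Fintype T] [DecidableEq ι] [Fintype ι]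

lemma pair_inj {a b : T → ι} (h : Function.Bijective (Sum.elim a b)) :
    (∀ t u, a t = a u ↔ t = u) ∧ (∀ t u, b t = b u ↔ t = u) ∧ (∀ t u, a t ≠ b u) ∧
      (∀ t u, b t ≠ a u) := by
  have hi := h.1
  refine ⟨fun t u => ⟨fun e => ?_, fun e => by rw [e]⟩, fun t u => ⟨fun e => ?_, fun e => by rw [e]⟩,
    fun t u e => ?_, fun t u e => ?_⟩
  · exact Sum.inl_injective (hi (a₁ := Sum.inl t) (a₂ := Sum.inl u) e)
  · exact Sum.inr_injective (hi (a₁ := Sum.inr t) (a₂ := Sum.inr u) e)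
  · exact absurd (hi (a₁ := Sum.inl t) (a₂ := Sum.inr u) e) (by simp)
  · exact absurd (hi (a₁ := Sum.inr t) (a₂ := Sum.inl u) e) (by simp)

lemma swap_other {a b : T → ι} (h : Function.Bijective (Sum.elim a b)) {t u : T} (htu : t ≠ u) :
    Equiv.swap (a u) (b u) (a t) = a t ∧ Equiv.swap (a u) (b u) (b t) = b t := by
  obtain ⟨h1, h2, h3, h4⟩ := pair_inj h
  constructor
  · exact Equiv.swap_apply_of_ne_of_ne (by simp [h1, htu]) (h3 _ _)
  · exact Equiv.swap_apply_of_ne_of_ne (h4 _ _) (by simp [h2, htu])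

lemma pairFix_other {a b : T → ι} (h : Function.Bijective (Sum.elim a b)) {t u : T} (htu : t ≠ u)
    (τ : Equiv.Perm ι) :
    pairFix a b t (τ * Equiv.swap (a u) (b u)) = pairFix a b t τ := by
  obtain ⟨h1, h2⟩ := swap_other h htu
  simp [pairFix, h1, h2]

lemma sum_pair {a b : T → ι} (h : Function.Bijective (Sum.elim a b)) (S : Finset T) :
    ∀ (H : Equiv.Perm ι → ℝ), (∀ t ∈ S, ∀ τ, H (τ * Equiv.swap (a t) (b t)) = H τ) →
    ∑ τ : Equiv.Perm ι, rsgn τ * (H τ * ∏ t ∈ S,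
      (pairFix a b t τ - pairFix a b t (τ * Equiv.swap (a t) (b t)))) =
    2 ^ S.card * ∑ τ : Equiv.Perm ι, rsgn τ * (H τ * ∏ t ∈ S, pairFix a b t τ) := by
  induction S using Finset.induction_on with
  | empty => intro H _; simp
  | insert t S ht ih =>
    intro H hH
    have key := ih (fun τ => H τ *
      (pairFix a b t τ - pairFix a b t (τ * Equiv.swap (a t) (b t)))) (by
        intro u hu τ
        have hne : t ≠ u := fun e => ht (e ▸ hu)
        have hcomm : τ * Equiv.swap (a u) (b u) * Equiv.swap (a t) (b t) =
            τ * Equiv.swap (a t) (b t) * Equiv.swap (a u) (b u) := by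
          obtain ⟨h1, h2, h3, h4⟩ := pair_inj h
          have : Equiv.Perm.Disjoint (Equiv.swap (a u) (b u)) (Equiv.swap (a t) (b t)) := by
            intro x
            by_cases hx : x = a t ∨ x = b t
            · left
              rcases hx with rfl | rfl
              · exact (swap_other h hne).1
              · exact (swap_other h hne).2
            · right
              push Not at hx
              exact Equiv.swap_apply_of_ne_of_ne hx.1 hx.2
          rw [mul_assoc, this.commute.eq, mul_assoc]
        rw [hcomm, pairFix_other h hne, pairFix_other h hne, hH u (Finset.mem_insert_of_mem hu)])
    have hab : a t ≠ b t := (pair_inj h).2.2.1 t t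
    calc _ = ∑ τ : Equiv.Perm ι, rsgn τ * ((fun τ => H τ *
      (pairFix a b t τ - pairFix a b t (τ * Equiv.swap (a t) (b t)))) τ * ∏ t ∈ S,
      (pairFix a b t τ - pairFix a b t (τ * Equiv.swap (a t) (b t)))) := by
          refine Finset.sum_congr rfl fun τ _ => ?_
          rw [Finset.prod_insert ht]; ring
      _ = _ := by
          rw [key, Finset.card_insert_of_notMem ht, pow_succ, mul_assoc]
          congr 1
          have e2 : ∑ τ : Equiv.Perm ι, rsgn τ * (H τ * (pairFix a b t (τ * Equiv.swap (a t) (b t)) *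
              ∏ t ∈ S, pairFix a b t τ)) = - ∑ τ : Equiv.Perm ι, rsgn τ * (H τ *
              ∏ t ∈ insert t S, pairFix a b t τ) := by
            rw [← Finset.sum_neg_distrib, ← Equiv.sum_comp (Equiv.mulRight (Equiv.swap (a t) (b t)))]
            refine Finset.sum_congr rfl fun τ _ => ?_
            simp only [Equiv.coe_mulRight]
            rw [hH t (Finset.mem_insert_self _ _), rsgn_mul, rsgn_swap hab, mul_assoc τ,
              Equiv.swap_mul_self, mul_one, Finset.prod_insert ht]
            have : ∏ u ∈ S, pairFix a b u (τ * Equiv.swap (a t) (b t)) = ∏ u ∈ S, pairFix a b u τ :=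
              Finset.prod_congr rfl fun u hu => pairFix_other h (ne_of_mem_of_not_mem hu ht) τ
            rw [this]; ring
          have e1 : ∀ τ : Equiv.Perm ι, rsgn τ * (H τ *
              (pairFix a b t τ - pairFix a b t (τ * Equiv.swap (a t) (b t))) *
              ∏ t ∈ S, pairFix a b t τ) = rsgn τ * (H τ * ∏ t ∈ insert t S, pairFix a b t τ) -
              rsgn τ * (H τ * (pairFix a b t (τ * Equiv.swap (a t) (b t)) *
              ∏ t ∈ S, pairFix a b t τ)) := by
            intro τ; rw [Finset.prod_insert ht]; ring
          simp only [e1, Finset.sum_sub_distrib]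
          rw [e2]; ring

lemma prod_pairFix {a b : T → ι} (S : Finset T) (τ : Equiv.Perm ι) :
    ∏ t ∈ S, pairFix a b t τ = if ∀ t ∈ S, τ (a t) = a t ∧ τ (b t) = b t then 1 else 0 := by
  have : ∀ t, pairFix a b t τ = if τ (a t) = a t ∧ τ (b t) = b t then 1 else 0 := by
    intro t; unfold pairFix; split_ifs <;> simp_all
  simp only [this]
  rw [Finset.prod_ite_zero]
  simp

lemma fix_all {a b : T → ι} (h : Function.Bijective (Sum.elim a b)) (τ : Equiv.Perm ι)
    (hf : ∀ t, τ (a t) = a t ∧ τ (b t) = b t) : τ = 1 := by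
  ext x
  obtain ⟨s, rfl⟩ := h.2 x
  rcases s with t | t
  · simpa using (hf t).1
  · simpa using (hf t).2

lemma term_zero {a b : T → ι} (h : Function.Bijective (Sum.elim a b)) :
    ∑ τ : Equiv.Perm ι, rsgn τ * ∏ t,
      (pairFix a b t τ - pairFix a b t (τ * Equiv.swap (a t) (b t))) = 2 ^ Fintype.card T := by
  have := sum_pair h Finset.univ (fun _ => 1) (by simp)
  simp only [one_mul] at this
  rw [this]
  have e : ∀ τ : Equiv.Perm ι, rsgn τ * ∏ t, pairFix a b t τ = if τ = 1 then 1 else 0 := by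
    intro τ
    rw [prod_pairFix]
    by_cases h1 : τ = 1
    · subst h1; simp [rsgn]
    · rw [if_neg, if_neg h1, mul_zero]
      intro hh; exact h1 (fix_all h τ fun t => hh t (Finset.mem_univ _))
  simp [e]

lemma fix_one {a b : T → ι} (h : Function.Bijective (Sum.elim a b)) (t : T) (τ : Equiv.Perm ι)
    (hf : ∀ u, u ≠ t → τ (a u) = a u ∧ τ (b u) = b u) :
    τ = 1 ∨ τ = Equiv.swap (a t) (b t) := by
  obtain ⟨h1, h2, h3, h4⟩ := pair_inj h
  have cl : ∀ x, x = a t ∨ x = b t → τ x = a t ∨ τ x = b t := by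
    intro x hx
    obtain ⟨s, hs⟩ := h.2 (τ x)
    have aux : ∀ y, τ y = y → τ x = y → x = y := fun y e1 e2 => τ.injective (e2.trans e1.symm)
    rcases s with u | u
    · simp only [Sum.elim_inl] at hs
      by_cases hu : u = t
      · left; rw [← hs, hu]
      · have := aux _ (hf u hu).1 hs.symm
        rcases hx with rfl | rfl
        · exact absurd ((h1 _ _).1 this).symm hu
        · exact absurd this (h4 _ _)
    · simp only [Sum.elim_inr] at hs
      by_cases hu : u = t
      · right; rw [← hs, hu]
      · have := aux _ (hf u hu).2 hs.symm
        rcases hx with rfl | rfl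
        · exact absurd this (h3 _ _)
        · exact absurd ((h2 _ _).1 this).symm hu
  have hne : τ (a t) ≠ τ (b t) := fun e => h3 t t (τ.injective e)
  rcases cl (a t) (Or.inl rfl) with ea | ea <;> rcases cl (b t) (Or.inr rfl) with eb | eb
  · exact absurd (ea.trans eb.symm) hne
  · left
    refine fix_all h τ fun u => ?_
    by_cases hu : u = t
    · subst hu; exact ⟨ea, eb⟩
    · exact hf u hu
  · right
    have : τ * Equiv.swap (a t) (b t) = 1 := by
      refine fix_all h _ fun u => ?_
      by_cases hu : u = t
      · subst hu; simp [ea, eb]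
      · obtain ⟨e1, e2⟩ := swap_other h hu
        simp [e1, e2, hf u hu]
    rw [mul_eq_one_iff_eq_inv, Equiv.swap_inv] at this
    exact this
  · exact absurd (ea.trans eb.symm) hne

lemma term_one {a b : T → ι} (h : Function.Bijective (Sum.elim a b)) (t : T) (W : ι → ι → ℝ)
    (hW : ∀ x y, W x y = - W y x) :
    ∑ τ : Equiv.Perm ι, rsgn τ * (W (τ (a t)) (τ (b t)) * ∏ u ∈ Finset.univ \ {t},
      (pairFix a b u τ - pairFix a b u (τ * Equiv.swap (a u) (b u)))) =
      2 ^ Fintype.card T * W (a t) (b t) := by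
  have hab : a t ≠ b t := (pair_inj h).2.2.1 t t
  rw [sum_pair h (Finset.univ \ {t}) (fun τ => W (τ (a t)) (τ (b t)))]
  · have hs : (1 : Equiv.Perm ι) ≠ Equiv.swap (a t) (b t) := by
      intro e
      have := congrArg (fun p : Equiv.Perm ι => p (a t)) e
      simp at this; exact hab this
    have e : ∀ τ : Equiv.Perm ι, rsgn τ * (W (τ (a t)) (τ (b t)) *
        ∏ u ∈ Finset.univ \ {t}, pairFix a b u τ) =
        (if τ = 1 then W (a t) (b t) else 0) +
          (if τ = Equiv.swap (a t) (b t) then W (a t) (b t) else 0) := by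
      intro τ
      rw [prod_pairFix]
      by_cases h1 : τ = 1
      · subst h1; simp [rsgn, hs]
      · by_cases h2 : τ = Equiv.swap (a t) (b t)
        · rw [if_pos, if_neg h1, if_pos h2, h2, rsgn_swap hab]
          · simp [hW (b t) (a t)]
          · intro u hu
            rw [h2]
            exact swap_other h (by simpa using hu)
        · rw [if_neg, if_neg h1, if_neg h2]
          · simp
          · intro hh
            rcases fix_one h t τ (fun u hu => hh u (by simpa using hu)) with h3 | h3
            · exact h1 h3
            · exact h2 h3
    have hc : (Finset.univ \ {t} : Finset T).card + 1 = Fintype.card T := by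
      rw [← Finset.erase_eq, Finset.card_erase_add_one (Finset.mem_univ _), Finset.card_univ]
    simp only [e, Finset.sum_add_distrib, Finset.sum_ite_eq', Finset.mem_univ, if_true]
    rw [← hc, pow_succ]; ring
  · intro u hu τ
    have := swap_other h (t := t) (u := u) (by
      have : u ≠ t := by simpa using hu
      exact this.symm)
    simp [this]

lemma term_two {a b : T → ι} (h : Function.Bijective (Sum.elim a b)) (t u : T) (htu : t ≠ u)
    (W W' : ι → ι → ℝ)
    (hW : ∀ x : Fin 4 → ι, ∑ ρ : Equiv.Perm (Fin 4), rsgn ρ *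
      (W (x (ρ 0)) (x (ρ 1)) * W' (x (ρ 2)) (x (ρ 3))) = 0)
    (R : Equiv.Perm ι → ℝ)
    (hR : ∀ τ π : Equiv.Perm ι, (∀ v, v ≠ t → v ≠ u → π (a v) = a v ∧ π (b v) = b v) →
      R (τ * π) = R τ) :
    ∑ τ : Equiv.Perm ι, rsgn τ * (W (τ (a t)) (τ (b t)) * W' (τ (a u)) (τ (b u)) * R τ) = 0 := by
  obtain ⟨h1, h2, h3, h4⟩ := pair_inj h
  have hinj : Function.Injective (![a t, b t, a u, b u] : Fin 4 → ι) := by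
    intro i j
    fin_cases i <;> fin_cases j <;> simp [h1, h2, h3, h4, htu, htu.symm]
  let f : Fin 4 ↪ ι := ⟨![a t, b t, a u, b u], hinj⟩
  set F : Equiv.Perm ι → ℝ := fun τ =>
    rsgn τ * (W (τ (a t)) (τ (b t)) * W' (τ (a u)) (τ (b u)) * R τ) with hF
  have hsum : ∀ ρ : Equiv.Perm (Fin 4), ∑ τ, F (τ * ρ.viaFintypeEmbedding f) = ∑ τ, F τ := by
    intro ρ
    exact Equiv.sum_comp (Equiv.mulRight (ρ.viaFintypeEmbedding f)) F
  have hz : ∑ ρ : Equiv.Perm (Fin 4), ∑ τ, F (τ * ρ.viaFintypeEmbedding f) = 0 := by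
    rw [Finset.sum_comm]
    refine Finset.sum_eq_zero fun τ _ => ?_
    have e : ∀ ρ : Equiv.Perm (Fin 4), F (τ * ρ.viaFintypeEmbedding f) =
        (rsgn τ * R τ) * (rsgn ρ * (W (τ (f (ρ 0))) (τ (f (ρ 1))) *
          W' (τ (f (ρ 2))) (τ (f (ρ 3))))) := by
      intro ρ
      have hs : rsgn (ρ.viaFintypeEmbedding f) = rsgn ρ := by
        simp [rsgn, Equiv.Perm.viaFintypeEmbedding_sign]
      have hv : ∀ i, ρ.viaFintypeEmbedding f (f i) = f (ρ i) :=
        fun i => Equiv.Perm.viaFintypeEmbedding_apply_image ρ f i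
      have v0 : ρ.viaFintypeEmbedding f (a t) = f (ρ 0) := hv 0
      have v1 : ρ.viaFintypeEmbedding f (b t) = f (ρ 1) := hv 1
      have v2 : ρ.viaFintypeEmbedding f (a u) = f (ρ 2) := hv 2
      have v3 : ρ.viaFintypeEmbedding f (b u) = f (ρ 3) := hv 3
      have hr : R (τ * ρ.viaFintypeEmbedding f) = R τ := by
        apply hR
        intro v hvt hvu
        constructor
        · apply Equiv.Perm.viaFintypeEmbedding_apply_notMem_range
          rintro ⟨i, hi⟩
          fin_cases i <;> simp [f, h1, h2, h3, h4, hvt.symm, hvu.symm] at hi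
        · apply Equiv.Perm.viaFintypeEmbedding_apply_notMem_range
          rintro ⟨i, hi⟩
          fin_cases i <;> simp [f, h1, h2, h3, h4, hvt.symm, hvu.symm] at hi
      simp only [hF, rsgn_mul, hs, Equiv.Perm.mul_apply, v0, v1, v2, v3, hr]
      ring
    simp only [e]
    rw [← Finset.mul_sum, hW (fun i => τ (f i)), mul_zero]
  simp only [hsum, Finset.sum_const, Finset.card_univ, nsmul_eq_mul] at hz
  rcases mul_eq_zero.1 hz with h0 | h0
  · exact absurd h0 (by simp [Fintype.card_ne_zero])
  · exact h0

lemma pfaff_inner_sum {a b : T → ι} (h : Function.Bijective (Sum.elim a b)) (W : T → ι → ι → ℝ)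
    (hW : ∀ t x y, W t x y = - W t y x)
    (hWW : ∀ t u, ∀ x : Fin 4 → ι, ∑ ρ : Equiv.Perm (Fin 4), rsgn ρ *
      (W t (x (ρ 0)) (x (ρ 1)) * W u (x (ρ 2)) (x (ρ 3))) = 0) (c : T → ℝ) :
    ∑ τ : Equiv.Perm ι, rsgn τ * ∏ t, (W t (τ (a t)) (τ (b t)) +
      c t * (pairFix a b t τ - pairFix a b t (τ * Equiv.swap (a t) (b t)))) =
    2 ^ Fintype.card T * ∏ t, c t +
      ∑ t, 2 ^ Fintype.card T * W t (a t) (b t) * ∏ u ∈ Finset.univ \ {t}, c u := by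
  let P : T → Equiv.Perm ι → ℝ :=
    fun t τ => pairFix a b t τ - pairFix a b t (τ * Equiv.swap (a t) (b t))
  let Q : Finset T → ℝ := fun S => ∑ τ : Equiv.Perm ι, rsgn τ *
      ((∏ t ∈ S, W t (τ (a t)) (τ (b t))) * ∏ t ∈ Finset.univ \ S, c t * P t τ)
  have hexp : ∑ τ : Equiv.Perm ι, rsgn τ * ∏ t, (W t (τ (a t)) (τ (b t)) + c t * P t τ) =
      ∑ S : Finset T, Q S := by
    simp only [Q]
    rw [Finset.sum_comm]
    refine Finset.sum_congr rfl fun τ _ => ?_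
    rw [Finset.prod_add, Finset.mul_sum, Finset.powerset_univ]
  have h0 : Q ∅ = 2 ^ Fintype.card T * ∏ t, c t := by
    rw [← term_zero h, Finset.sum_mul]
    refine Finset.sum_congr rfl fun τ _ => ?_
    simp only [Finset.prod_empty, Finset.sdiff_empty, one_mul, Finset.prod_mul_distrib, P]
    ring
  have h1 : ∀ t, Q {t} =
      2 ^ Fintype.card T * W t (a t) (b t) * ∏ u ∈ Finset.univ \ {t}, c u := by
    intro t
    rw [← term_one h t (W t) (hW t), Finset.sum_mul]
    refine Finset.sum_congr rfl fun τ _ => ?_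
    simp only [Finset.prod_singleton, Finset.prod_mul_distrib, P]
    ring
  have h2 : ∀ S : Finset T, 1 < S.card → Q S = 0 := by
    intro S hS
    obtain ⟨t, ht, u, hu, htu⟩ := Finset.one_lt_card.1 hS
    have hu' : u ∈ S.erase t := Finset.mem_erase.2 ⟨htu.symm, hu⟩
    rw [← term_two h t u htu (W t) (W u) (hWW t u)
      (fun τ => (∏ v ∈ (S.erase t).erase u, W v (τ (a v)) (τ (b v))) *
        ∏ v ∈ Finset.univ \ S, c v * P v τ)]
    · refine Finset.sum_congr rfl fun τ _ => ?_
      rw [← Finset.mul_prod_erase S _ ht, ← Finset.mul_prod_erase (S.erase t) _ hu']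
      ring
    · intro τ π hπ
      congr 1
      · refine Finset.prod_congr rfl fun v hv => ?_
        simp only [Finset.mem_erase] at hv
        obtain ⟨e1, e2⟩ := hπ v hv.2.1 hv.1
        simp [e1, e2]
      · refine Finset.prod_congr rfl fun v hv => ?_
        have hvS : v ∉ S := by simpa using hv
        obtain ⟨e1, e2⟩ := hπ v (fun e => hvS (e ▸ ht)) (fun e => hvS (e ▸ hu))
        simp [P, pairFix, e1, e2]
  rw [show (∑ τ : Equiv.Perm ι, rsgn τ * ∏ t, (W t (τ (a t)) (τ (b t)) +
      c t * (pairFix a b t τ - pairFix a b t (τ * Equiv.swap (a t) (b t))))) = _ from hexp]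
  have hQ : ∀ S, Q S = (if S = ∅ then Q ∅ else 0) + ∑ t, if S = {t} then Q {t} else 0 := by
    intro S
    rcases Nat.lt_or_ge 1 S.card with hc | hc
    · rw [h2 S hc, if_neg, Finset.sum_eq_zero, add_zero]
      · intro t _
        rw [if_neg]; rintro rfl; simp at hc
      · rintro rfl; simp at hc
    · rcases Nat.eq_zero_or_pos S.card with hz | hz
      · rw [Finset.card_eq_zero] at hz
        subst hz
        simp [(Finset.singleton_ne_empty _).symm]
      · obtain ⟨t, rfl⟩ := Finset.card_eq_one.1 (le_antisymm hc hz)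
        simp
  rw [Finset.sum_congr rfl fun S _ => hQ S, Finset.sum_add_distrib, Finset.sum_comm]
  simp [h0, h1]

end core

lemma exists_perm_pair {ι : Type*} [DecidableEq ι] {a b i j : ι} (hab : a ≠ b) (hij : i ≠ j) :
    ∃ π : Equiv.Perm ι, π a = i ∧ π b = j := by
  refine ⟨Equiv.swap (Equiv.swap a i b) j * Equiv.swap a i, ?_, ?_⟩
  · simp only [Equiv.Perm.mul_apply, Equiv.swap_apply_left]
    refine Equiv.swap_apply_of_ne_of_ne ?_ hij
    intro e
    apply hab
    apply (Equiv.swap a i).injective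
    rw [Equiv.swap_apply_left]; exact e
  · simp

lemma card_pair {ι : Type*} [DecidableEq ι] [Fintype ι] {a b a' b' i j : ι} (hab : a ≠ b)
    (hab' : a' ≠ b') (hij : i ≠ j) :
    (Finset.univ.filter fun σ : Equiv.Perm ι => σ a = i ∧ σ b = j).card =
    (Finset.univ.filter fun σ : Equiv.Perm ι => σ a' = a' ∧ σ b' = b').card := by
  obtain ⟨π, p1, p2⟩ := exists_perm_pair hab' hij
  obtain ⟨ρ, r1, r2⟩ := exists_perm_pair hab' hab
  refine (Finset.card_equiv ((Equiv.mulLeft π).trans (Equiv.mulRight ρ⁻¹)) ?_).symm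
  intro σ
  have e1 : ρ⁻¹ a = a' := by rw [← r1]; simp
  have e2 : ρ⁻¹ b = b' := by rw [← r2]; simp
  simp only [Finset.mem_filter, Finset.mem_univ, true_and, Equiv.trans_apply, Equiv.coe_mulLeft,
    Equiv.coe_mulRight, Equiv.Perm.mul_apply, e1, e2, ← p1, ← p2, EmbeddingLike.apply_eq_iff_eq]

lemma sum_perm_pair {ι : Type*} [DecidableEq ι] [Fintype ι] {a b a' b' : ι} (hab : a ≠ b)
    (hab' : a' ≠ b') (g : ι → ι → ℝ) (hg : ∀ i, g i i = 0) :
    ∑ σ : Equiv.Perm ι, g (σ a) (σ b) =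
    ((Finset.univ.filter fun σ : Equiv.Perm ι => σ a' = a' ∧ σ b' = b').card : ℝ) *
      ∑ i, ∑ j, g i j := by
  have e : ∀ σ : Equiv.Perm ι, g (σ a) (σ b) =
      ∑ i, ∑ j, if σ a = i ∧ σ b = j then g i j else 0 := by
    intro σ
    simp [ite_and]
  simp only [e]
  rw [Finset.sum_comm, Finset.mul_sum]
  refine Finset.sum_congr rfl fun i _ => ?_
  rw [Finset.sum_comm, Finset.mul_sum]
  refine Finset.sum_congr rfl fun j _ => ?_
  by_cases hij : i = j
  · subst hij; simp [hg]
  · rw [← card_pair hab hab' hij, ← Finset.sum_filter, Finset.sum_const, nsmul_eq_mul]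

lemma sum_symm_Ioi {k : ℕ} (g : Fin k → Fin k → ℝ) (hg : ∀ i, g i i = 0)
    (hs : ∀ i j, g i j = g j i) :
    ∑ i, ∑ j, g i j = 2 * ∑ i, ∑ j ∈ Finset.Ioi i, g i j := by
  have e : ∀ i j, g i j = (if i < j then g i j else 0) + (if j < i then g j i else 0) := by
    intro i j
    rcases lt_trichotomy i j with h | h | h
    · simp [h, h.not_gt]
    · subst h; simp [hg]
    · simp [h, h.not_gt, hs i j]
  have e' : ∀ i, ∑ j ∈ Finset.Ioi i, g i j = ∑ j, if i < j then g i j else 0 := by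
    intro i
    rw [← Finset.sum_filter]
    congr 1
    ext; simp
  simp only [e']
  rw [Finset.sum_congr rfl fun i _ => Finset.sum_congr rfl fun j _ => e i j]
  simp only [Finset.sum_add_distrib]
  rw [Finset.sum_comm (f := fun i j => if j < i then g j i else 0)]
  ring

lemma prod_pairs {T ι : Type*} [Fintype T] [Fintype ι] {a b : T → ι}
    (h : Function.Bijective (Sum.elim a b)) (f : ι → ℝ) :
    ∏ t, (f (a t) * f (b t)) = ∏ x, f x := by
  rw [← Function.Bijective.prod_comp h f, Fintype.prod_sum_type, Finset.prod_mul_distrib]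
  simp

lemma prod_pairs_erase {T ι : Type*} [DecidableEq T] [DecidableEq ι] [Fintype T] [Fintype ι]
    {a b : T → ι} (h : Function.Bijective (Sum.elim a b)) (f : ι → ℝ) (t : T) :
    ∏ u ∈ Finset.univ \ {t}, (f (a u) * f (b u)) = ∏ x ∈ Finset.univ \ {a t, b t}, f x := by
  obtain ⟨h1, h2, h3, h4⟩ := pair_inj h
  have e := prod_pairs h (fun x => if x ∈ Finset.univ \ {a t, b t} then f x else 1)
  rw [← Finset.prod_filter, Finset.filter_mem_eq_inter, Finset.univ_inter] at e
  rw [← e, ← Finset.mul_prod_erase Finset.univ _ (Finset.mem_univ t), Finset.erase_eq]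
  simp only [Finset.mem_sdiff, Finset.mem_univ, true_and, Finset.mem_insert, Finset.mem_singleton,
    true_or, or_true, not_true_eq_false, if_false, one_mul]
  refine Finset.prod_congr rfl fun u hu => ?_
  have hut : u ≠ t := by simpa using hu
  simp [h1, h2, h3, h4, hut]

lemma main_sum {k : ℕ} {T : Type*} [DecidableEq T] [Fintype T] {a b : T → Fin k}
    (h : Function.Bijective (Sum.elim a b)) {a' b' : Fin k} (hab' : a' ≠ b')
    (V : Type*) [AddCommGroup V] [Module ℝ V]
    (B : Module.Basis (Fin k) ℝ V) (κ : Fin k → ℝ)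
    (Ω : Fin k → Fin k → V →ₗ[ℝ] V →ₗ[ℝ] ℝ)
    (hΩ : ∀ (i j : Fin k) (X : V), Ω i j X X = 0)
    (hΩ' : ∀ i j : Fin k, Ω i j = - Ω j i)
    (hw : ∀ (i j p q : Fin k) (X : Fin 4 → V),
          ∑ ρ : Equiv.Perm (Fin 4), ((Equiv.Perm.sign ρ : ℤ) : ℝ) *
            (Ω i j (X (ρ 0)) (X (ρ 1)) * Ω p q (X (ρ 2)) (X (ρ 3))) = 0) :
    ∑ σ : Equiv.Perm (Fin k), ∑ τ : Equiv.Perm (Fin k), rsgn σ * rsgn τ * ∏ t : T,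
      (Ω (σ (a t)) (σ (b t)) (B (τ (a t))) (B (τ (b t))) + κ (σ (a t)) * κ (σ (b t)) *
        (B.coord (σ (a t)) (B (τ (a t))) * B.coord (σ (b t)) (B (τ (b t))) -
          B.coord (σ (b t)) (B (τ (a t))) * B.coord (σ (a t)) (B (τ (b t))))) =
    2 ^ Fintype.card T * (Nat.factorial k : ℝ) * ∏ ℓ : Fin k, κ ℓ +
      (2 ^ Fintype.card T * (Fintype.card T : ℝ) * ((Finset.univ.filter
        fun σ : Equiv.Perm (Fin k) => σ a' = a' ∧ σ b' = b').card : ℝ) * 2) *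
        ∑ i : Fin k, ∑ j ∈ Finset.Ioi i,
              Ω i j (B i) (B j) * ∏ ℓ ∈ Finset.univ \ {i, j}, κ ℓ := by
  have alt : ∀ i j (X Y : V), Ω i j X Y = - Ω i j Y X := by
    intro i j X Y
    have := hΩ i j (X + Y)
    simp only [map_add, LinearMap.add_apply, hΩ] at this
    linarith
  set g : Fin k → Fin k → ℝ :=
    fun i j => Ω i j (B i) (B j) * ∏ ℓ ∈ Finset.univ \ {i, j}, κ ℓ with hg
  have hg0 : ∀ i, g i i = 0 := by intro i; simp [hg, hΩ]
  have hgs : ∀ i j, g i j = g j i := by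
    intro i j
    simp only [hg]
    rw [hΩ' i j, LinearMap.neg_apply, LinearMap.neg_apply, alt j i, neg_neg, Finset.pair_comm]
  have inner : ∀ σ : Equiv.Perm (Fin k), ∑ τ : Equiv.Perm (Fin k), rsgn σ * rsgn τ * ∏ t : T,
      (Ω (σ (a t)) (σ (b t)) (B (τ (a t))) (B (τ (b t))) + κ (σ (a t)) * κ (σ (b t)) *
        (B.coord (σ (a t)) (B (τ (a t))) * B.coord (σ (b t)) (B (τ (b t))) -
          B.coord (σ (b t)) (B (τ (a t))) * B.coord (σ (a t)) (B (τ (b t))))) =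
      2 ^ Fintype.card T * ∏ ℓ, κ ℓ +
        ∑ t : T, 2 ^ Fintype.card T * g (σ (a t)) (σ (b t)) := by
    intro σ
    have key := pfaff_inner_sum h (fun t x y => Ω (σ (a t)) (σ (b t)) (B (σ x)) (B (σ y)))
      (fun t x y => alt _ _ _ _)
      (fun t u x => hw _ _ _ _ (fun i => B (σ (x i))))
      (fun t => κ (σ (a t)) * κ (σ (b t)))
    have hσ : ∏ t, (κ (σ (a t)) * κ (σ (b t))) = ∏ ℓ, κ ℓ := by
      rw [prod_pairs h (fun x => κ (σ x)), Equiv.prod_comp σ κ]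
    have hσ' : Function.Bijective (Sum.elim (fun t => σ (a t)) (fun t => σ (b t))) := by
      have := σ.bijective.comp h
      convert this using 1
      ext x; cases x <;> rfl
    have hσ'' := fun t => prod_pairs_erase hσ' κ t
    simp only [hσ, hσ''] at key
    rw [← Equiv.sum_comp (Equiv.mulLeft σ)]
    calc _ = _ := ?_
      _ = _ := key
      _ = _ := by simp only [hg, mul_assoc]
    refine Finset.sum_congr rfl fun τ _ => ?_
    simp only [Equiv.coe_mulLeft, rsgn_mul]
    rw [← mul_assoc, rsgn_sq, one_mul]
    congr 1
    refine Finset.prod_congr rfl fun t _ => ?_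
    congr 1
    simp only [Equiv.Perm.mul_apply, Module.Basis.coord_apply, Module.Basis.repr_self,
      Finsupp.single_apply, pairFix, Equiv.swap_apply_left, Equiv.swap_apply_right,
      EmbeddingLike.apply_eq_iff_eq]
    ring
  rw [Finset.sum_congr rfl fun σ _ => inner σ, Finset.sum_add_distrib, Finset.sum_comm]
  have hs : ∀ t : T, ∑ σ : Equiv.Perm (Fin k), 2 ^ Fintype.card T * g (σ (a t)) (σ (b t)) =
      2 ^ Fintype.card T * (((Finset.univ.filter
        fun σ : Equiv.Perm (Fin k) => σ a' = a' ∧ σ b' = b').card : ℝ) *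
        (2 * ∑ i, ∑ j ∈ Finset.Ioi i, g i j)) := by
    intro t
    rw [← Finset.mul_sum, sum_perm_pair ((pair_inj h).2.2.1 t t) hab' g hg0, sum_symm_Ioi g hg0 hgs]
  simp only [hs, Finset.sum_const, Finset.card_univ, nsmul_eq_mul, Fintype.card_perm,
    Fintype.card_fin]
  ring



/-- Gauss-equation substitution in the Pfaffian: if all pairwise wedge products of the
ambient curvature 2-forms `Ω_{ij}` vanish, then the Pfaffian sum of the family
`A_{ij} = Ω_{ij} + κ_i κ_j θ_i ∧ θ_j` evaluated on the basis equals the Gauss-Kronecker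
term `2^(k/2) k! ∏ κ_ℓ` plus a universal positive constant `c_k` times the correction
term `Σ_{i<j} Ω_{ij}(e_i,e_j) ∏_{ℓ∉{i,j}} κ_ℓ`. -/
theorem stmt_8 (k : ℕ) (hk : 2 ≤ k) (hke : Even k) :
    ∃ c : ℝ, 0 < c ∧
      ∀ (V : Type u) [AddCommGroup V] [Module ℝ V]
        (b : Module.Basis (Fin k) ℝ V) (κ : Fin k → ℝ)
        (Ω : Fin k → Fin k → V →ₗ[ℝ] V →ₗ[ℝ] ℝ),
        (∀ (i j : Fin k) (X : V), Ω i j X X = 0) →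
        (∀ i j : Fin k, Ω i j = - Ω j i) →
        (∀ (i j p q : Fin k) (X : Fin 4 → V),
          ∑ ρ : Equiv.Perm (Fin 4), ((Equiv.Perm.sign ρ : ℤ) : ℝ) *
            (Ω i j (X (ρ 0)) (X (ρ 1)) * Ω p q (X (ρ 2)) (X (ρ 3))) = 0) →
        ∑ σ : Equiv.Perm (Fin k), ∑ τ : Equiv.Perm (Fin k),
          ((Equiv.Perm.sign σ : ℤ) : ℝ) * ((Equiv.Perm.sign τ : ℤ) : ℝ) *
            ∏ t : Fin (k / 2),
              (Ω (σ ⟨2 * t, by have := t.isLt; omega⟩)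
                  (σ ⟨2 * t + 1, by have := t.isLt; omega⟩)
                  (b (τ ⟨2 * t, by have := t.isLt; omega⟩))
                  (b (τ ⟨2 * t + 1, by have := t.isLt; omega⟩)) +
                κ (σ ⟨2 * t, by have := t.isLt; omega⟩) *
                  κ (σ ⟨2 * t + 1, by have := t.isLt; omega⟩) *
                  (b.coord (σ ⟨2 * t, by have := t.isLt; omega⟩)
                      (b (τ ⟨2 * t, by have := t.isLt; omega⟩)) *
                    b.coord (σ ⟨2 * t + 1, by have := t.isLt; omega⟩)
                      (b (τ ⟨2 * t + 1, by have := t.isLt; omega⟩)) -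
                    b.coord (σ ⟨2 * t + 1, by have := t.isLt; omega⟩)
                      (b (τ ⟨2 * t, by have := t.isLt; omega⟩)) *
                    b.coord (σ ⟨2 * t, by have := t.isLt; omega⟩)
                      (b (τ ⟨2 * t + 1, by have := t.isLt; omega⟩)))) =
          2 ^ (k / 2) * (Nat.factorial k : ℝ) * ∏ ℓ : Fin k, κ ℓ +
            c * ∑ i : Fin k, ∑ j ∈ Finset.Ioi i,
              Ω i j (b i) (b j) * ∏ ℓ ∈ Finset.univ \ {i, j}, κ ℓ := by
  have h0 : 0 < k := by omega
  have h1 : 1 < k := by omega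
  have hab' : (⟨0, h0⟩ : Fin k) ≠ ⟨1, h1⟩ := by simp
  have hbij : Function.Bijective (Sum.elim
      (fun t : Fin (k / 2) => (⟨2 * t, by have := t.isLt; omega⟩ : Fin k))
      (fun t : Fin (k / 2) => (⟨2 * t + 1, by have := t.isLt; omega⟩ : Fin k))) := by
    constructor
    · rintro (t | t) (u | u) e <;> simp [Fin.ext_iff] at e ⊢ <;> omega
    · intro x
      have hx := x.isLt
      obtain ⟨m, hm⟩ := hke
      rcases Nat.even_or_odd' x.1 with ⟨c, hc | hc⟩
      · exact ⟨Sum.inl ⟨c, by omega⟩, by simp [Fin.ext_iff, hc]⟩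
      · exact ⟨Sum.inr ⟨c, by omega⟩, by simp [Fin.ext_iff, hc]⟩
  refine ⟨2 ^ (k / 2) * ((k / 2 : ℕ) : ℝ) * ((Finset.univ.filter
        fun σ : Equiv.Perm (Fin k) => σ ⟨0, h0⟩ = ⟨0, h0⟩ ∧ σ ⟨1, h1⟩ = ⟨1, h1⟩).card : ℝ) * 2,
    ?_, ?_⟩
  · have hm : 0 < k / 2 := by omega
    have hc : 0 < (Finset.univ.filter
        fun σ : Equiv.Perm (Fin k) => σ ⟨0, h0⟩ = ⟨0, h0⟩ ∧ σ ⟨1, h1⟩ = ⟨1, h1⟩).card :=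
      Finset.card_pos.2 ⟨1, by simp⟩
    have hm' : (0 : ℝ) < ((k / 2 : ℕ) : ℝ) := by exact_mod_cast hm
    positivity
  · intro V _ _ b κ Ω hΩ hΩ' hw
    have := main_sum hbij hab' V b κ Ω hΩ hΩ' hw
    rw [Fintype.card_fin] at this
    exact this
end

section
/- Let m ≥ 3, let V be a real vector space with basis e₁, …, e_m and dual basis θ₁, …, θ_m, let κ₁, …, κ_m be real numbers, and for i, j ∈ {1,…,m} let Ω_{ij} : V × V → ℝ be alternating bilinear maps with Ω_{ij} = −Ω_{ji}. Define α_i := κ_i θ_i. Then Σ_{σ, τ ∈ S_m} sgn(σ) sgn(τ) · (∏_{t=1}^{m−2} α_{σ(t)}(e_{τ(t)})) · Ω_{σ(m−1) σ(m)}(e_{τ(m−1)}, e_{τ(m)}) = 4 · (m−2)! · Σ_{1 ≤ i < j ≤ m} Ω_{ij}(e_i, e_j) · ∏_{ℓ ∉ {i,j}} κ_ℓ. -/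
/-- Any ordered pair of distinct points can be moved to any other by a permutation. -/
theorem exists_perm_pair_s11 {α : Type*} [DecidableEq α] {p q a c : α} (hpq : p ≠ q) (hac : a ≠ c) :
    ∃ ρ : Equiv.Perm α, ρ p = a ∧ ρ q = c := by
  refine ⟨Equiv.swap (Equiv.swap p a q) c * Equiv.swap p a, ?_, ?_⟩
  · have h : a ≠ Equiv.swap p a q := by
      intro h
      have h2 : Equiv.swap p a p = Equiv.swap p a q := by rw [Equiv.swap_apply_left]; exact h
      exact hpq ((Equiv.swap p a).injective h2)
    rw [Equiv.Perm.mul_apply, Equiv.swap_apply_left, Equiv.swap_apply_of_ne_of_ne h hac]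
  · rw [Equiv.Perm.mul_apply, Equiv.swap_apply_left]

theorem sum_perm_pair_s11 (n : ℕ) (F : Fin (n + 2) → Fin (n + 2) → ℝ) (hF : ∀ i, F i i = 0)
    (p q : Fin (n + 2)) (hpq : p ≠ q) :
    ∑ σ : Equiv.Perm (Fin (n + 2)), F (σ p) (σ q) = (n.factorial : ℝ) * ∑ i, ∑ j, F i j := by
  set S := ∑ σ : Equiv.Perm (Fin (n + 2)), F (σ p) (σ q) with hS
  have key : ∀ a c : Fin (n + 2), ∑ σ : Equiv.Perm (Fin (n + 2)), F (σ a) (σ c)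
      = S - if a = c then S else 0 := by
    intro a c
    by_cases hac : a = c
    · subst hac
      simp [hF]
    · obtain ⟨ρ, h1, h2⟩ := exists_perm_pair_s11 hpq hac
      rw [if_neg hac, sub_zero, hS, ← Equiv.sum_comp (Equiv.mulRight ρ)
        (fun σ : Equiv.Perm (Fin (n + 2)) => F (σ p) (σ q))]
      simp [h1, h2]
  have e1 : ∑ a, ∑ c, ∑ σ : Equiv.Perm (Fin (n + 2)), F (σ a) (σ c)
      = ((n : ℝ) + 2) * ((n : ℝ) + 1) * S := by
    simp only [key, Finset.sum_sub_distrib, Finset.sum_ite_eq, Finset.mem_univ, if_true,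
      Finset.sum_const, Finset.card_univ, Fintype.card_fin, nsmul_eq_mul]
    push_cast
    ring
  have e2 : ∑ a, ∑ c, ∑ σ : Equiv.Perm (Fin (n + 2)), F (σ a) (σ c)
      = ((n + 2).factorial : ℝ) * ∑ i, ∑ j, F i j := by
    have h : ∀ σ : Equiv.Perm (Fin (n + 2)), ∑ a, ∑ c, F (σ a) (σ c) = ∑ i, ∑ j, F i j := by
      intro σ
      rw [← Equiv.sum_comp σ (fun i => ∑ j, F i j)]
      refine Finset.sum_congr rfl fun a _ => ?_
      exact Equiv.sum_comp σ (fun j => F (σ a) j)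
    calc ∑ a, ∑ c, ∑ σ : Equiv.Perm (Fin (n + 2)), F (σ a) (σ c)
        = ∑ σ : Equiv.Perm (Fin (n + 2)), ∑ a, ∑ c, F (σ a) (σ c) := by
          rw [Finset.sum_comm]
          rw [Finset.sum_comm]
          simp_rw [Finset.sum_comm (s := (Finset.univ : Finset (Fin (n+2))))
            (t := (Finset.univ : Finset (Equiv.Perm (Fin (n+2)))))]
      _ = _ := by
          simp only [h, Finset.sum_const, Finset.card_univ, Fintype.card_perm, Fintype.card_fin,
            nsmul_eq_mul]
  have e3 : ((n + 2).factorial : ℝ) = ((n : ℝ) + 2) * ((n : ℝ) + 1) * n.factorial := by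
    rw [Nat.factorial_succ, Nat.factorial_succ]
    push_cast
    ring
  have hne : ((n : ℝ) + 2) * ((n : ℝ) + 1) ≠ 0 := by positivity
  apply mul_left_cancel₀ hne
  rw [← e1, e2, e3]
  ring

theorem sum_symm_pair (m : ℕ) (F : Fin m → Fin m → ℝ) (hF : ∀ i, F i i = 0)
    (hs : ∀ i j, F i j = F j i) :
    ∑ i, ∑ j, F i j = 2 * ∑ i, ∑ j ∈ Finset.Ioi i, F i j := by
  have h := Finset.sum_sum_Ioi_add_eq_sum_sum_off_diag F
  have h1 : ∀ i, ∑ j ∈ ({i}ᶜ : Finset (Fin m)), F j i = ∑ j, F i j := by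
    intro i
    rw [← Finset.sum_compl_add_sum {i} (fun j => F i j)]
    simp only [Finset.sum_singleton, hF, add_zero]
    exact Finset.sum_congr rfl fun j _ => hs j i
  simp only [h1] at h
  rw [← h, Finset.mul_sum]
  refine Finset.sum_congr rfl fun i _ => ?_
  rw [Finset.mul_sum]
  refine Finset.sum_congr rfl fun j _ => ?_
  rw [hs j i]
  ring

theorem perm_two_cases (n : ℕ) (p q : Fin (n + 2)) (hpq : p ≠ q)
    (σ τ : Equiv.Perm (Fin (n + 2))) (h : ∀ x, x ≠ p → x ≠ q → σ x = τ x) :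
    τ = σ ∨ τ = σ * Equiv.swap p q := by
  have hp : τ p = σ p ∨ τ p = σ q := by
    obtain ⟨x, hx⟩ := σ.surjective (τ p)
    by_cases h1 : x = p
    · left; rw [← hx, h1]
    by_cases h2 : x = q
    · right; rw [← hx, h2]
    exact absurd (τ.injective ((h x h1 h2).symm.trans hx)) h1
  have hq : τ q = σ p ∨ τ q = σ q := by
    obtain ⟨x, hx⟩ := σ.surjective (τ q)
    by_cases h1 : x = p
    · left; rw [← hx, h1]
    by_cases h2 : x = q
    · right; rw [← hx, h2]
    exact absurd (τ.injective ((h x h1 h2).symm.trans hx)) h2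
  have hne : τ p ≠ τ q := fun e => hpq (τ.injective e)
  rcases hp with hp | hp
  · have hq' : τ q = σ q := by
      rcases hq with hq | hq
      · exact absurd (hp.trans hq.symm) hne
      · exact hq
    left
    ext1 x
    by_cases h1 : x = p
    · rw [h1, hp]
    by_cases h2 : x = q
    · rw [h2, hq']
    exact (h x h1 h2).symm
  · have hq' : τ q = σ p := by
      rcases hq with hq | hq
      · exact hq
      · exact absurd (hp.trans hq.symm) hne
    right
    ext1 x
    by_cases h1 : x = p
    · rw [h1, hp, Equiv.Perm.mul_apply, Equiv.swap_apply_left]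
    by_cases h2 : x = q
    · rw [h2, hq', Equiv.Perm.mul_apply, Equiv.swap_apply_right]
    rw [Equiv.Perm.mul_apply, Equiv.swap_apply_of_ne_of_ne h1 h2]
    exact (h x h1 h2).symm

theorem prod_compl_pair (n : ℕ) (κ : Fin (n + 2) → ℝ) (σ : Equiv.Perm (Fin (n + 2))) :
    ∏ t : Fin n, κ (σ ⟨t, by omega⟩)
      = ∏ l ∈ Finset.univ \ {σ ⟨n, by omega⟩, σ ⟨n + 1, by omega⟩}, κ l := by
  refine Finset.prod_bij (fun t _ => σ ⟨t, by omega⟩) ?_ ?_ ?_ ?_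
  · intro t _
    have := t.isLt
    simp only [Finset.mem_sdiff, Finset.mem_univ, true_and, Finset.mem_insert,
      Finset.mem_singleton, EmbeddingLike.apply_eq_iff_eq, Fin.mk.injEq]
    omega
  · intro t _ s _ h
    have := σ.injective h
    simp only [Fin.mk.injEq] at this
    exact Fin.ext this
  · intro l hl
    obtain ⟨x, rfl⟩ := σ.surjective l
    simp only [Finset.mem_sdiff, Finset.mem_univ, true_and, Finset.mem_insert,
      Finset.mem_singleton, EmbeddingLike.apply_eq_iff_eq, Fin.ext_iff] at hl
    have := x.isLt
    exact ⟨⟨x, by omega⟩, Finset.mem_univ _, rfl⟩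
  · intro t _
    rfl

theorem stmt_aux {V : Type*} [AddCommGroup V] [Module ℝ V] (n : ℕ)
    (b : Module.Basis (Fin (n + 2)) ℝ V) (κ : Fin (n + 2) → ℝ)
    (Ω : Fin (n + 2) → Fin (n + 2) → V →ₗ[ℝ] V →ₗ[ℝ] ℝ)
    (halt : ∀ (i j : Fin (n + 2)) (X : V), Ω i j X X = 0)
    (hskew : ∀ i j : Fin (n + 2), Ω i j = - Ω j i) :
    ∑ σ : Equiv.Perm (Fin (n + 2)), ∑ τ : Equiv.Perm (Fin (n + 2)),
      ((Equiv.Perm.sign σ : ℤ) : ℝ) * ((Equiv.Perm.sign τ : ℤ) : ℝ) *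
        ((∏ t : Fin n,
            (κ (σ ⟨t, by omega⟩) *
              b.coord (σ ⟨t, by omega⟩) (b (τ ⟨t, by omega⟩)))) *
          Ω (σ ⟨n, by omega⟩) (σ ⟨n + 1, by omega⟩)
            (b (τ ⟨n, by omega⟩)) (b (τ ⟨n + 1, by omega⟩))) =
      4 * (Nat.factorial n : ℝ) *
        ∑ i : Fin (n + 2), ∑ j ∈ Finset.Ioi i,
          Ω i j (b i) (b j) * ∏ l ∈ Finset.univ \ {i, j}, κ l := by
  have hsw : ∀ i j X Y, Ω i j X Y = - Ω i j Y X := by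
    intro i j X Y
    have h := halt i j (X + Y)
    simp only [map_add, LinearMap.add_apply, halt] at h
    linarith
  set F : Fin (n + 2) → Fin (n + 2) → ℝ := fun i j =>
    Ω i j (b i) (b j) * ∏ l ∈ Finset.univ \ {i, j}, κ l with hFdef
  have hF : ∀ i, F i i = 0 := fun i => by simp [hFdef, halt]
  have hs : ∀ i j, F i j = F j i := by
    intro i j
    simp only [hFdef]
    rw [hsw, hskew i j, Finset.pair_comm i j]
    simp
  have hpq : (⟨n, by omega⟩ : Fin (n + 2)) ≠ ⟨n + 1, by omega⟩ := by
    simp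
  have inner : ∀ σ : Equiv.Perm (Fin (n + 2)), ∑ τ : Equiv.Perm (Fin (n + 2)),
      ((Equiv.Perm.sign σ : ℤ) : ℝ) * ((Equiv.Perm.sign τ : ℤ) : ℝ) *
        ((∏ t : Fin n,
            (κ (σ ⟨t, by omega⟩) *
              b.coord (σ ⟨t, by omega⟩) (b (τ ⟨t, by omega⟩)))) *
          Ω (σ ⟨n, by omega⟩) (σ ⟨n + 1, by omega⟩)
            (b (τ ⟨n, by omega⟩)) (b (τ ⟨n + 1, by omega⟩)))
      = 2 * F (σ ⟨n, by omega⟩) (σ ⟨n + 1, by omega⟩) := by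
    intro σ
    have hsq : ((Equiv.Perm.sign σ : ℤ) : ℝ) * ((Equiv.Perm.sign σ : ℤ) : ℝ) = 1 := by
      rcases Int.units_eq_one_or (Equiv.Perm.sign σ) with h | h <;> simp [h]
    have hne : σ ≠ σ * Equiv.swap (⟨n, by omega⟩ : Fin (n + 2)) ⟨n + 1, by omega⟩ := by
      intro h
      have h2 := congrArg (fun f : Equiv.Perm (Fin (n + 2)) => f ⟨n, by omega⟩) h
      simp only [Equiv.Perm.mul_apply, Equiv.swap_apply_left] at h2
      exact hpq (σ.injective h2)
    rw [← Finset.sum_subset (Finset.subset_univ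
      {σ, σ * Equiv.swap (⟨n, by omega⟩ : Fin (n + 2)) ⟨n + 1, by omega⟩}) ?_]
    · rw [Finset.sum_pair hne]
      have hfix : ∀ t : Fin n, Equiv.swap (⟨n, by omega⟩ : Fin (n + 2)) ⟨n + 1, by omega⟩
          ⟨t, by omega⟩ = ⟨t, by omega⟩ := by
        intro t
        have := t.isLt
        apply Equiv.swap_apply_of_ne_of_ne <;> simp only [ne_eq, Fin.mk.injEq] <;> omega
      simp only [Equiv.Perm.mul_apply, hfix, Equiv.swap_apply_left, Equiv.swap_apply_right,
        Module.Basis.coord_apply, Module.Basis.repr_self, Finsupp.single_eq_same, mul_one,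
        Equiv.Perm.sign_mul, Equiv.Perm.sign_swap hpq]
      rw [prod_compl_pair, hsw _ _ (b (σ ⟨n + 1, by omega⟩))]
      simp only [hFdef]
      push_cast
      linear_combination (2 * (Ω (σ ⟨n, by omega⟩) (σ ⟨n + 1, by omega⟩)
        (b (σ ⟨n, by omega⟩)) (b (σ ⟨n + 1, by omega⟩)) *
        ∏ l ∈ Finset.univ \ {σ ⟨n, by omega⟩, σ ⟨n + 1, by omega⟩}, κ l)) * hsq
    · intro τ _ hτ
      have : ∃ t : Fin n, σ ⟨t, by omega⟩ ≠ τ ⟨t, by omega⟩ := by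
        by_contra! hcon
        apply hτ
        have := perm_two_cases n _ _ hpq σ τ (fun x h1 h2 => by
          have hx := x.isLt
          simp only [ne_eq, Fin.ext_iff] at h1 h2
          exact hcon ⟨x, by omega⟩)
        simpa using this
      obtain ⟨t, ht⟩ := this
      rw [Finset.prod_eq_zero (Finset.mem_univ t)]
      · simp
      · simp [Finsupp.single_apply, Ne.symm ht]
  rw [Finset.sum_congr rfl (fun σ _ => inner σ), ← Finset.mul_sum,
    sum_perm_pair_s11 n F hF _ _ hpq, sum_symm_pair _ F hF hs]
  ring

/-- The `s = 1` term of the Chern transgression form, with shape-operator 1-forms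
`α_i = κ_i θ_i` and ambient curvature 2-forms `Ω_{ij}`, evaluated on the basis: only
the diagonal components `Ω_{ij}(e_i,e_j)` contribute, weighted by the complementary
principal curvatures, with total constant `4 (m−2)!`. -/
theorem stmt_11 {V : Type*} [AddCommGroup V] [Module ℝ V]
    (m : ℕ) (hm : 3 ≤ m)
    (b : Module.Basis (Fin m) ℝ V) (κ : Fin m → ℝ)
    (Ω : Fin m → Fin m → V →ₗ[ℝ] V →ₗ[ℝ] ℝ)
    (halt : ∀ (i j : Fin m) (X : V), Ω i j X X = 0)
    (hskew : ∀ i j : Fin m, Ω i j = - Ω j i) :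
    ∑ σ : Equiv.Perm (Fin m), ∑ τ : Equiv.Perm (Fin m),
      ((Equiv.Perm.sign σ : ℤ) : ℝ) * ((Equiv.Perm.sign τ : ℤ) : ℝ) *
        ((∏ t : Fin (m - 2),
            (κ (σ ⟨t, by have := t.isLt; omega⟩) *
              b.coord (σ ⟨t, by have := t.isLt; omega⟩)
                (b (τ ⟨t, by have := t.isLt; omega⟩)))) *
          Ω (σ ⟨m - 2, by omega⟩) (σ ⟨m - 1, by omega⟩)
            (b (τ ⟨m - 2, by omega⟩)) (b (τ ⟨m - 1, by omega⟩))) =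
      4 * (Nat.factorial (m - 2) : ℝ) *
        ∑ i : Fin m, ∑ j ∈ Finset.Ioi i,
          Ω i j (b i) (b j) * ∏ ℓ ∈ Finset.univ \ {i, j}, κ ℓ := by
  obtain ⟨n, rfl⟩ : ∃ n, m = n + 2 := ⟨m - 2, by omega⟩
  exact stmt_aux n b κ Ω halt hskew
end

section
/- Let m ≥ 1 and let s be an integer with 2 ≤ s ≤ (m−1)/2 (so that m − 2s ≥ 1). Let V be a real vector space with basis e₁, …, e_m, let β₁, …, β_m : V → ℝ be linear functionals, and for i, j ∈ {1,…,m} let Ω_{ij} : V × V → ℝ be alternating bilinear maps such that for all indices i, j, p, q and all X₁, X₂, X₃, X₄ ∈ V: Σ_{ρ ∈ S₄} sgn(ρ) Ω_{ij}(X_{ρ(1)}, X_{ρ(2)}) Ω_{pq}(X_{ρ(3)}, X_{ρ(4)}) = 0. Then Σ_{σ, τ ∈ S_m} sgn(σ) sgn(τ) · (∏_{t=1}^{m−2s} β_{σ(t)}(e_{τ(t)})) · (∏_{u=1}^{s} Ω_{σ(m−2s+2u−1) σ(m−2s+2u)}(e_{τ(m−2s+2u−1)}, e_{τ(m−2s+2u)}))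 = 0. -/
/-- Every term of the Chern transgression form containing `s ≥ 2` ambient curvature
factors vanishes, provided all pairwise wedge products of the ambient curvature 2-forms
`Ω_{ij}` vanish. -/
theorem stmt_12 {V : Type*} [AddCommGroup V] [Module ℝ V]
    (m s : ℕ) (hm : 1 ≤ m) (hs2 : 2 ≤ s) (hsm : s ≤ (m - 1) / 2)
    (b : Module.Basis (Fin m) ℝ V)
    (β : Fin m → V →ₗ[ℝ] ℝ)
    (Ω : Fin m → Fin m → V →ₗ[ℝ] V →ₗ[ℝ] ℝ)
    (halt : ∀ (i j : Fin m) (X : V), Ω i j X X = 0)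
    (hwedge : ∀ (i j p q : Fin m) (X : Fin 4 → V),
      ∑ ρ : Equiv.Perm (Fin 4), ((Equiv.Perm.sign ρ : ℤ) : ℝ) *
        (Ω i j (X (ρ 0)) (X (ρ 1)) * Ω p q (X (ρ 2)) (X (ρ 3))) = 0) :
    ∑ σ : Equiv.Perm (Fin m), ∑ τ : Equiv.Perm (Fin m),
      ((Equiv.Perm.sign σ : ℤ) : ℝ) * ((Equiv.Perm.sign τ : ℤ) : ℝ) *
        ((∏ t : Fin (m - 2 * s),
            β (σ ⟨t, by have := t.isLt; omega⟩) (b (τ ⟨t, by have := t.isLt; omega⟩))) *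
          ∏ u : Fin s,
            Ω (σ ⟨m - 2 * s + 2 * u, by have := u.isLt; omega⟩)
              (σ ⟨m - 2 * s + 2 * u + 1, by have := u.isLt; omega⟩)
              (b (τ ⟨m - 2 * s + 2 * u, by have := u.isLt; omega⟩))
              (b (τ ⟨m - 2 * s + 2 * u + 1, by have := u.isLt; omega⟩))) = 0 := by
  refine Finset.sum_eq_zero fun σ _ => ?_
  obtain ⟨r, rfl⟩ : ∃ r, s = r + 2 := ⟨s - 2, by omega⟩
  let f : Fin 4 ↪ Fin m :=
    ⟨fun k => ⟨m - 2 * (r + 2) + k, by have := k.isLt; omega⟩, fun a c h => by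
      have := congrArg Fin.val h
      simp only at this
      exact Fin.ext (by omega)⟩
  have key : ∀ F : Equiv.Perm (Fin m) → ℝ,
      (∀ τ, ∑ ρ : Equiv.Perm (Fin 4), F (τ * ρ.viaFintypeEmbedding f) = 0) →
      ∑ τ, F τ = 0 := by
    intro F hF
    have h1 : ∀ ρ : Equiv.Perm (Fin 4),
        ∑ τ, F (τ * ρ.viaFintypeEmbedding f) = ∑ τ, F τ := fun ρ =>
      Equiv.sum_comp (Equiv.mulRight (ρ.viaFintypeEmbedding f)) F
    have h2 : ∑ ρ : Equiv.Perm (Fin 4), ∑ τ, F (τ * ρ.viaFintypeEmbedding f) = 0 := by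
      rw [Finset.sum_comm]
      exact Finset.sum_eq_zero fun τ _ => hF τ
    simp only [h1, Finset.sum_const, nsmul_eq_mul] at h2
    rcases mul_eq_zero.mp h2 with h | h
    · simp [Fintype.card_perm, Nat.factorial_ne_zero] at h
    · exact h
  apply key
  intro τ
  have hout : ∀ (ρ : Equiv.Perm (Fin 4)) (x : Fin m),
      (x.val < m - 2 * (r + 2) ∨ m - 2 * (r + 2) + 4 ≤ x.val) →
      ρ.viaFintypeEmbedding f x = x := by
    intro ρ x hx
    apply Equiv.Perm.viaFintypeEmbedding_apply_notMem_range
    rintro ⟨k, rfl⟩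
    have := k.isLt
    have hfk : (f k).val = m - 2 * (r + 2) + k.val := rfl
    omega
  have hin : ∀ (ρ : Equiv.Perm (Fin 4)) (k : Fin 4) (x : Fin m), x = f k →
      ρ.viaFintypeEmbedding f x = f (ρ k) := by
    rintro ρ k x rfl
    exact Equiv.Perm.viaFintypeEmbedding_apply_image ρ f k
  have hw := hwedge (σ (f 0)) (σ (f 1)) (σ (f 2)) (σ (f 3)) (fun k => b (τ (f k)))
  have hβ : ∀ (ρ : Equiv.Perm (Fin 4)) (t : Fin (m - 2 * (r + 2))) (h : t.val < m),
      ρ.viaFintypeEmbedding f ⟨t, h⟩ = ⟨t, h⟩ := fun ρ t h => hout ρ _ (Or.inl t.isLt)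
  have hΩ1 : ∀ (ρ : Equiv.Perm (Fin 4)) (u : Fin r) (h : m - 2 * (r + 2) + 2 * (u.val + 1 + 1) < m),
      ρ.viaFintypeEmbedding f ⟨m - 2 * (r + 2) + 2 * (u.val + 1 + 1), h⟩ = ⟨_, h⟩ :=
    fun ρ u h => hout ρ _ (Or.inr (by simp only; omega))
  have hΩ2 : ∀ (ρ : Equiv.Perm (Fin 4)) (u : Fin r)
      (h : m - 2 * (r + 2) + 2 * (u.val + 1 + 1) + 1 < m),
      ρ.viaFintypeEmbedding f ⟨m - 2 * (r + 2) + 2 * (u.val + 1 + 1) + 1, h⟩ = ⟨_, h⟩ :=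
    fun ρ u h => hout ρ _ (Or.inr (by simp only; omega))
  have h0 : ∀ (ρ : Equiv.Perm (Fin 4)) h,
      ρ.viaFintypeEmbedding f ⟨m - 2 * (r + 2) + 2 * 0, h⟩ = f (ρ 0) :=
    fun ρ h => hin ρ 0 _ rfl
  have h1 : ∀ (ρ : Equiv.Perm (Fin 4)) h,
      ρ.viaFintypeEmbedding f ⟨m - 2 * (r + 2) + 2 * 0 + 1, h⟩ = f (ρ 1) :=
    fun ρ h => hin ρ 1 _ rfl
  have h2 : ∀ (ρ : Equiv.Perm (Fin 4)) h,
      ρ.viaFintypeEmbedding f ⟨m - 2 * (r + 2) + 2 * (0 + 1), h⟩ = f (ρ 2) :=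
    fun ρ h => hin ρ 2 _ rfl
  have h3 : ∀ (ρ : Equiv.Perm (Fin 4)) h,
      ρ.viaFintypeEmbedding f ⟨m - 2 * (r + 2) + 2 * (0 + 1) + 1, h⟩ = f (ρ 3) :=
    fun ρ h => hin ρ 3 _ rfl
  simp only [Fin.prod_univ_succ, Fin.val_succ, Fin.val_zero, Equiv.Perm.mul_apply, hβ, hΩ1, hΩ2,
    h0, h1, h2, h3, Equiv.Perm.sign_mul, Equiv.Perm.viaFintypeEmbedding_sign, Units.val_mul,
    Int.cast_mul]
  rw [← mul_zero (((Equiv.Perm.sign σ : ℤ) : ℝ) * ((Equiv.Perm.sign τ : ℤ) : ℝ) *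
    ((∏ t : Fin (m - 2 * (r + 2)),
      β (σ ⟨t, by have := t.isLt; omega⟩) (b (τ ⟨t, by have := t.isLt; omega⟩))) *
    ∏ u : Fin r,
      Ω (σ ⟨m - 2 * (r + 2) + 2 * (u + 1 + 1), by have := u.isLt; omega⟩)
        (σ ⟨m - 2 * (r + 2) + 2 * (u + 1 + 1) + 1, by have := u.isLt; omega⟩)
        (b (τ ⟨m - 2 * (r + 2) + 2 * (u + 1 + 1), by have := u.isLt; omega⟩))
        (b (τ ⟨m - 2 * (r + 2) + 2 * (u + 1 + 1) + 1, by have := u.isLt; omega⟩)))), ← hw,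
    Finset.mul_sum]
  refine Finset.sum_congr rfl fun ρ _ => ?_
  have e0 : ∀ h, (⟨m - 2 * (r + 2) + 2 * 0, h⟩ : Fin m) = f 0 := fun h => rfl
  have e1 : ∀ h, (⟨m - 2 * (r + 2) + 2 * 0 + 1, h⟩ : Fin m) = f 1 := fun h => rfl
  have e2 : ∀ h, (⟨m - 2 * (r + 2) + 2 * (0 + 1), h⟩ : Fin m) = f 2 := fun h => rfl
  have e3 : ∀ h, (⟨m - 2 * (r + 2) + 2 * (0 + 1) + 1, h⟩ : Fin m) = f 3 := fun h => rfl
  simp only [e0, e1, e2, e3]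
  ring
end

section
/- Let m ≥ 3 be an odd integer, let V be a real vector space with basis e₁, …, e_m and dual basis θ₁, …, θ_m, let κ₁, …, κ_m be real numbers with κ_ℓ ≥ 0 for all ℓ, and for i, j ∈ {1,…,m} let Ω_{ij} : V × V → ℝ be alternating bilinear maps with Ω_{ij} = −Ω_{ji}, satisfying: (a) for all indices i, j, p, q and all X₁, X₂, X₃, X₄ ∈ V, Σ_{ρ ∈ S₄} sgn(ρ) Ω_{ij}(X_{ρ(1)}, X_{ρ(2)}) Ω_{pq}(X_{ρ(3)}, X_{ρ(4)}) = 0; and (b) Ω_{ij}(e_i, e_j) ≤ 0 for all 1 ≤ i < j ≤ m. Define α_i := κ_i θ_i, and for 0 ≤ s ≤ (m−1)/2 define Φ_s := Σ_{σ, τ ∈ S_m} sgn(σ) sgn(τ) (∏_{t=1}^{m−2s} α_{σ(t)}(e_{τ(t)})) (∏_{u=1}^{s} Ω_{σ(m−2s+2u−1) σ(m−2s+2u)}(e_{τ(m−2s+2u−1)}, e_{τ(m−2s+2u)})). Then for any nonnegative real numbers λ₁, …, λ_{(m−1)/2}: (1/m!) · Φ₀ + Σ_{s=1}^{(m−1)/2}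 λ_s · Φ_s ≤ ∏_{ℓ=1}^{m} κ_ℓ. -/
/-- The double-permutation-sum expression `Φ_s` for the `s`-th term of the Chern
transgression form, built from the 1-forms `α_i` and the 2-forms `Ω_{ij}`, evaluated
on the frame `e`:
`Φ_s = Σ_{σ,τ ∈ S_m} sgn σ sgn τ (∏_{t=1}^{m−2s} α_{σ(t)}(e_{τ(t)}))
  (∏_{u=1}^{s} Ω_{σ(m−2s+2u−1)σ(m−2s+2u)}(e_{τ(m−2s+2u−1)}, e_{τ(m−2s+2u)}))`. -/
def transgressionTerm {V : Type*} [AddCommGroup V] [Module ℝ V] {m : ℕ}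
    (e : Fin m → V) (α : Fin m → V →ₗ[ℝ] ℝ)
    (Ω : Fin m → Fin m → V →ₗ[ℝ] V →ₗ[ℝ] ℝ)
    (s : ℕ) (hs : 2 * s + 1 ≤ m) : ℝ :=
  ∑ σ : Equiv.Perm (Fin m), ∑ τ : Equiv.Perm (Fin m),
    ((Equiv.Perm.sign σ : ℤ) : ℝ) * ((Equiv.Perm.sign τ : ℤ) : ℝ) *
      ((∏ t : Fin (m - 2 * s),
          α (σ ⟨t, by have := t.isLt; omega⟩) (e (τ ⟨t, by have := t.isLt; omega⟩))) *
        ∏ u : Fin s,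
          Ω (σ ⟨m - 2 * s + 2 * u, by have := u.isLt; omega⟩)
            (σ ⟨m - 2 * s + 2 * u + 1, by have := u.isLt; omega⟩)
            (e (τ ⟨m - 2 * s + 2 * u, by have := u.isLt; omega⟩))
            (e (τ ⟨m - 2 * s + 2 * u + 1, by have := u.isLt; omega⟩)))

lemma term_zero_s13 {V : Type*} [AddCommGroup V] [Module ℝ V] (m : ℕ)
    (b : Module.Basis (Fin m) ℝ V) (κ : Fin m → ℝ)
    (Ω : Fin m → Fin m → V →ₗ[ℝ] V →ₗ[ℝ] ℝ) (h : 2 * 0 + 1 ≤ m) :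
    transgressionTerm b (fun i => κ i • b.coord i) Ω 0 h
      = (Nat.factorial m : ℝ) * ∏ ℓ, κ ℓ := by
  unfold transgressionTerm
  have key : ∀ σ : Equiv.Perm (Fin m), (∑ τ : Equiv.Perm (Fin m),
    ((Equiv.Perm.sign σ : ℤ) : ℝ) * ((Equiv.Perm.sign τ : ℤ) : ℝ) *
      ((∏ t : Fin m, (κ (σ t) • b.coord (σ t)) (b (τ t))))) = ∏ ℓ, κ ℓ := by
    intro σ
    rw [Finset.sum_eq_single σ]
    · have h1 : ((Equiv.Perm.sign σ : ℤ) : ℝ) * ((Equiv.Perm.sign σ : ℤ) : ℝ) = 1 := by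
        rcases Int.units_eq_one_or (Equiv.Perm.sign σ) with h | h <;> simp [h]
      rw [h1, one_mul]
      simp only [LinearMap.smul_apply, Module.Basis.coord_apply, Module.Basis.repr_self,
        Finsupp.single_eq_same, smul_eq_mul, mul_one]
      exact Equiv.prod_comp σ κ
    · intro τ _ hne
      obtain ⟨t, ht⟩ : ∃ t, τ t ≠ σ t := by
        by_contra! hc
        exact hne (Equiv.ext hc)
      rw [Finset.prod_eq_zero (Finset.mem_univ t), mul_zero]
      simp [Finsupp.single_apply, ht]
    · simp
  have h2 := Finset.sum_congr (rfl : (Finset.univ : Finset (Equiv.Perm (Fin m))) = _)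
    (fun σ _ => key σ)
  rw [Finset.sum_const, Finset.card_univ, Fintype.card_perm, Fintype.card_fin,
    nsmul_eq_mul] at h2
  rw [← h2]
  refine Finset.sum_congr rfl fun σ _ => Finset.sum_congr rfl fun τ _ => ?_
  simp only [Finset.univ_eq_empty, Finset.prod_empty, mul_one]
  rfl

lemma term_one_s13 {V : Type*} [AddCommGroup V] [Module ℝ V] (m : ℕ)
    (b : Module.Basis (Fin m) ℝ V) (κ : Fin m → ℝ) (hκ : ∀ ℓ, 0 ≤ κ ℓ)
    (Ω : Fin m → Fin m → V →ₗ[ℝ] V →ₗ[ℝ] ℝ)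
    (halt : ∀ (i j : Fin m) (X : V), Ω i j X X = 0)
    (hskew : ∀ i j : Fin m, Ω i j = - Ω j i)
    (hneg : ∀ i j : Fin m, i < j → Ω i j (b i) (b j) ≤ 0) (h : 2 * 1 + 1 ≤ m) :
    transgressionTerm b (fun i => κ i • b.coord i) Ω 1 h ≤ 0 := by
  unfold transgressionTerm
  have hsw : ∀ i j (X Y : V), Ω i j X Y = - Ω i j Y X := by
    intro i j X Y
    have := halt i j (X + Y)
    simp only [map_add, LinearMap.add_apply, halt] at this
    linarith
  have hneg' : ∀ i j : Fin m, i ≠ j → Ω i j (b i) (b j) ≤ 0 := by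
    intro i j hij
    rcases lt_or_gt_of_ne hij with hl | hl
    · exact hneg i j hl
    · rw [hskew, LinearMap.neg_apply, LinearMap.neg_apply, hsw, neg_neg]
      exact hneg j i hl
  refine Finset.sum_nonpos fun σ _ => Finset.sum_nonpos fun τ _ => ?_
  by_cases hst : ∃ t : Fin (m - 2 * 1), τ ⟨t, by omega⟩ ≠ σ ⟨t, by omega⟩
  · obtain ⟨t, ht⟩ := hst
    rw [Finset.prod_eq_zero (Finset.mem_univ t), zero_mul, mul_zero]
    simp [Finsupp.single_apply, ht]
  push Not at hst
  have hprod : 0 ≤ ∏ t : Fin (m - 2 * 1), (κ (σ ⟨t, by omega⟩) • b.coord (σ ⟨t, by omega⟩))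
      (b (τ ⟨t, by omega⟩)) := by
    refine Finset.prod_nonneg fun t _ => ?_
    rw [hst t]
    simp [hκ]
  rw [Fin.prod_univ_one, mul_left_comm]
  refine mul_nonpos_of_nonneg_of_nonpos hprod ?_
  have h1 : ((Equiv.Perm.sign σ : ℤ) : ℝ) * ((Equiv.Perm.sign σ : ℤ) : ℝ) = 1 := by
    rcases Int.units_eq_one_or (Equiv.Perm.sign σ) with h | h <;> simp [h]
  obtain ⟨p, hp⟩ : ∃ p : Fin m, p = ⟨m - 2 * 1 + 2 * ((0 : Fin 1) : ℕ), by simp; omega⟩ :=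
    ⟨_, rfl⟩
  obtain ⟨q, hq⟩ : ∃ q : Fin m, q = ⟨m - 2 * 1 + 2 * ((0 : Fin 1) : ℕ) + 1, by simp; omega⟩ :=
    ⟨_, rfl⟩
  rw [← hp, ← hq]
  have hpv : (p : ℕ) = m - 2 := by simp [hp]
  have hqv : (q : ℕ) = m - 2 + 1 := by simp [hq]
  have hpq : p ≠ q := by
    intro h
    rw [h] at hpv
    omega
  have hother : ∀ x : Fin m, x ≠ p → x ≠ q → τ x = σ x := by
    intro x hx1 hx2
    have h1 : (x : ℕ) ≠ p := fun h => hx1 (Fin.ext h)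
    have h2 : (x : ℕ) ≠ q := fun h => hx2 (Fin.ext h)
    exact hst ⟨x, by have := x.isLt; omega⟩
  -- the value of τ at p
  have hval : ∀ x : Fin m, (x = p ∨ x = q) → (τ x = σ p ∨ τ x = σ q) := by
    intro x hx
    by_contra! hc
    have hy1 : σ.symm (τ x) ≠ p := fun h => hc.1 (by rw [← h]; simp)
    have hy2 : σ.symm (τ x) ≠ q := fun h => hc.2 (by rw [← h]; simp)
    have h3 := hother _ hy1 hy2
    rw [Equiv.apply_symm_apply] at h3
    have h4 := τ.injective h3
    rcases hx with hx | hx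
    · exact hy1 (h4.trans hx)
    · exact hy2 (h4.trans hx)
  have hne : τ p ≠ τ q := fun h => hpq (τ.injective h)
  rcases hval p (Or.inl rfl) with hA | hA
  · have hB : τ q = σ q := by
      rcases hval q (Or.inr rfl) with hB | hB
      · exact absurd (hA.trans hB.symm) hne
      · exact hB
    have : τ = σ := by
      ext1 x
      by_cases h1 : x = p
      · rw [h1, hA]
      by_cases h2 : x = q
      · rw [h2, hB]
      exact hother x h1 h2
    rw [this, h1, one_mul]
    exact hneg' _ _ (fun h => hpq (σ.injective h))
  · have hB : τ q = σ p := by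
      rcases hval q (Or.inr rfl) with hB | hB
      · exact hB
      · exact absurd (hA.trans hB.symm) hne
    have : τ = σ * Equiv.swap p q := by
      ext1 x
      rw [Equiv.Perm.mul_apply]
      by_cases h1 : x = p
      · rw [h1, hA, Equiv.swap_apply_left]
      by_cases h2 : x = q
      · rw [h2, hB, Equiv.swap_apply_right]
      rw [Equiv.swap_apply_of_ne_of_ne h1 h2]
      exact hother x h1 h2
    rw [hA, hB, this, Equiv.Perm.sign_mul, Equiv.Perm.sign_swap hpq, hsw]
    have := hneg' _ _ (fun h => hpq (σ.injective h))
    push_cast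
    linear_combination this + (Ω (σ p) (σ q) (b (σ p)) (b (σ q))) * h1

lemma term_ge_two {V : Type*} [AddCommGroup V] [Module ℝ V] (m : ℕ)
    (e : Fin m → V) (α : Fin m → V →ₗ[ℝ] ℝ)
    (Ω : Fin m → Fin m → V →ₗ[ℝ] V →ₗ[ℝ] ℝ)
    (hwedge : ∀ (i j p q : Fin m) (X : Fin 4 → V),
      ∑ ρ : Equiv.Perm (Fin 4), ((Equiv.Perm.sign ρ : ℤ) : ℝ) *
        (Ω i j (X (ρ 0)) (X (ρ 1)) * Ω p q (X (ρ 2)) (X (ρ 3))) = 0)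
    (r : ℕ) (h : 2 * (r + 2) + 1 ≤ m) :
    transgressionTerm e α Ω (r + 2) h = 0 := by
  unfold transgressionTerm
  refine Finset.sum_eq_zero fun σ _ => ?_
  let f : Fin 4 ↪ Fin m :=
    ⟨fun k => ⟨m - 2 * (r + 2) + 2 * r + k, by omega⟩, fun x y hxy => by
      simp only [Fin.mk.injEq] at hxy
      exact Fin.ext (by omega)⟩
  have hf : ∀ x, x ∉ Set.range f ∨ ∃ k, f k = x := fun x => by
    by_cases hx : x ∈ Set.range f
    · exact Or.inr hx
    · exact Or.inl hx
  have hnot : ∀ (n : ℕ) (hn : n < m), n < m - 2 * (r + 2) + 2 * r →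
      (⟨n, hn⟩ : Fin m) ∉ Set.range f := by
    rintro n hn hlt ⟨k, hk⟩
    have : m - 2 * (r + 2) + 2 * r + k = n := congrArg Fin.val hk
    omega
  obtain ⟨G, hG⟩ : ∃ G : Equiv.Perm (Fin m) → ℝ, G = fun τ =>
    ((Equiv.Perm.sign σ : ℤ) : ℝ) * ((Equiv.Perm.sign τ : ℤ) : ℝ) *
      ((∏ t : Fin (m - 2 * (r + 2)),
          α (σ ⟨t, by have := t.isLt; omega⟩) (e (τ ⟨t, by have := t.isLt; omega⟩))) *
        ∏ u : Fin (r + 2),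
          Ω (σ ⟨m - 2 * (r + 2) + 2 * u, by have := u.isLt; omega⟩)
            (σ ⟨m - 2 * (r + 2) + 2 * u + 1, by have := u.isLt; omega⟩)
            (e (τ ⟨m - 2 * (r + 2) + 2 * u, by have := u.isLt; omega⟩))
            (e (τ ⟨m - 2 * (r + 2) + 2 * u + 1, by have := u.isLt; omega⟩))) := ⟨_, rfl⟩
  change ∑ τ, (_ : ℝ) = 0
  have hGs : ∑ τ, G τ = 0 := by
    have hzero : ∀ τ, ∑ ρ : Equiv.Perm (Fin 4), G (τ * ρ.viaFintypeEmbedding f) = 0 := by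
      intro τ
      have hw := hwedge (σ (f 0)) (σ (f 1)) (σ (f 2)) (σ (f 3)) (fun k => e (τ (f k)))
      have hterm : ∀ ρ : Equiv.Perm (Fin 4), G (τ * ρ.viaFintypeEmbedding f) =
          (((Equiv.Perm.sign σ : ℤ) : ℝ) * ((Equiv.Perm.sign τ : ℤ) : ℝ) *
          ((∏ t : Fin (m - 2 * (r + 2)),
            α (σ ⟨t, by have := t.isLt; omega⟩) (e (τ ⟨t, by have := t.isLt; omega⟩))) *
          ∏ u : Fin r,
            Ω (σ ⟨m - 2 * (r + 2) + 2 * u, by have := u.isLt; omega⟩)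
            (σ ⟨m - 2 * (r + 2) + 2 * u + 1, by have := u.isLt; omega⟩)
            (e (τ ⟨m - 2 * (r + 2) + 2 * u, by have := u.isLt; omega⟩))
            (e (τ ⟨m - 2 * (r + 2) + 2 * u + 1, by have := u.isLt; omega⟩)))) *
          (((Equiv.Perm.sign ρ : ℤ) : ℝ) *
            (Ω (σ (f 0)) (σ (f 1)) (e (τ (f (ρ 0)))) (e (τ (f (ρ 1)))) *
              Ω (σ (f 2)) (σ (f 3)) (e (τ (f (ρ 2)))) (e (τ (f (ρ 3)))))) := by
        intro ρ
        have happ : ∀ k, (τ * ρ.viaFintypeEmbedding f) (f k) = τ (f (ρ k)) := by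
          intro k
          rw [Equiv.Perm.mul_apply, Equiv.Perm.viaFintypeEmbedding_apply_image]
        have hfix : ∀ (n : ℕ) (hn : n < m), n < m - 2 * (r + 2) + 2 * r →
            (τ * ρ.viaFintypeEmbedding f) ⟨n, hn⟩ = τ ⟨n, hn⟩ := by
          intro n hn hlt
          rw [Equiv.Perm.mul_apply,
            Equiv.Perm.viaFintypeEmbedding_apply_notMem_range _ _ (hnot n hn hlt)]
        rw [hG]
        dsimp only
        rw [Fin.prod_univ_castSucc, Fin.prod_univ_castSucc]
        have e1 : ∀ t : Fin (m - 2 * (r + 2)),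
            (τ * ρ.viaFintypeEmbedding f) ⟨t, by have := t.isLt; omega⟩ =
              τ ⟨t, by have := t.isLt; omega⟩ := fun t => hfix _ _ (by omega)
        have e2 : ∀ u : Fin r,
            (τ * ρ.viaFintypeEmbedding f) ⟨m - 2 * (r + 2) + 2 * u, by omega⟩ =
              τ ⟨m - 2 * (r + 2) + 2 * u, by omega⟩ := fun u => hfix _ _ (by omega)
        have e3 : ∀ u : Fin r,
            (τ * ρ.viaFintypeEmbedding f) ⟨m - 2 * (r + 2) + 2 * u + 1, by omega⟩ =
              τ ⟨m - 2 * (r + 2) + 2 * u + 1, by omega⟩ := fun u => hfix _ _ (by omega)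
        simp only [Fin.val_castSucc, Fin.val_last]
        simp only [e1, e2, e3]
        rw [← happ 0, ← happ 1, ← happ 2, ← happ 3, Equiv.Perm.sign_mul,
          Equiv.Perm.viaFintypeEmbedding_sign]
        have f0 : f 0 = ⟨m - 2 * (r + 2) + 2 * r, by omega⟩ := rfl
        have f1 : f 1 = ⟨m - 2 * (r + 2) + 2 * r + 1, by omega⟩ := rfl
        have f2 : f 2 = ⟨m - 2 * (r + 2) + 2 * (r + 1), by omega⟩ := rfl
        have f3 : f 3 = ⟨m - 2 * (r + 2) + 2 * (r + 1) + 1, by omega⟩ := rfl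
        rw [f0, f1, f2, f3]
        push_cast
        ring
      rw [Finset.sum_congr rfl (fun ρ _ => hterm ρ), ← Finset.mul_sum, hw, mul_zero]
    have hsum : ∑ τ, ∑ ρ : Equiv.Perm (Fin 4), G (τ * ρ.viaFintypeEmbedding f) = 0 :=
      Finset.sum_eq_zero fun τ _ => hzero τ
    rw [Finset.sum_comm] at hsum
    have hre : ∀ ρ : Equiv.Perm (Fin 4), ∑ τ, G (τ * ρ.viaFintypeEmbedding f) = ∑ τ, G τ :=
      fun ρ => Equiv.sum_comp (Equiv.mulRight (ρ.viaFintypeEmbedding f)) G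
    rw [Finset.sum_congr rfl (fun ρ _ => hre ρ), Finset.sum_const, Finset.card_univ,
      nsmul_eq_mul] at hsum
    rcases mul_eq_zero.mp hsum with h0 | h0
    · exact absurd (Nat.cast_eq_zero.mp h0) Fintype.card_ne_zero
    · exact h0
  rw [hG] at hGs
  exact hGs

/-- Pointwise inequality `TPf_Γ ≤ GK` for the Chern transgression term of an
odd-dimensional hypersurface: with shape-operator 1-forms `α_i = κ_i θ_i` (`κ_ℓ ≥ 0`),
ambient curvature 2-forms `Ω_{ij}` with vanishing pairwise wedge products and
`Ω_{ij}(e_i,e_j) ≤ 0` for `i < j`, and any nonnegative weights `λ_s`, we have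
`(1/m!) Φ₀ + Σ_{s=1}^{(m−1)/2} λ_s Φ_s ≤ ∏ κ_ℓ`. -/
theorem stmt_13 {V : Type*} [AddCommGroup V] [Module ℝ V]
    (m : ℕ) (hm : 3 ≤ m) (hmo : Odd m)
    (b : Module.Basis (Fin m) ℝ V) (κ : Fin m → ℝ) (hκ : ∀ ℓ, 0 ≤ κ ℓ)
    (Ω : Fin m → Fin m → V →ₗ[ℝ] V →ₗ[ℝ] ℝ)
    (halt : ∀ (i j : Fin m) (X : V), Ω i j X X = 0)
    (hskew : ∀ i j : Fin m, Ω i j = - Ω j i)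
    (hwedge : ∀ (i j p q : Fin m) (X : Fin 4 → V),
      ∑ ρ : Equiv.Perm (Fin 4), ((Equiv.Perm.sign ρ : ℤ) : ℝ) *
        (Ω i j (X (ρ 0)) (X (ρ 1)) * Ω p q (X (ρ 2)) (X (ρ 3))) = 0)
    (hneg : ∀ i j : Fin m, i < j → Ω i j (b i) (b j) ≤ 0)
    (lam : ℕ → ℝ) (hlam : ∀ s ∈ Finset.Icc 1 ((m - 1) / 2), 0 ≤ lam s) :
    (1 / (Nat.factorial m : ℝ)) *
        transgressionTerm b (fun i => κ i • b.coord i) Ω 0 (by omega) +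
      ∑ s ∈ (Finset.Icc 1 ((m - 1) / 2)).attach,
        lam s.1 *
          transgressionTerm b (fun i => κ i • b.coord i) Ω s.1
            (by have := Finset.mem_Icc.mp s.2; omega) ≤
      ∏ ℓ : Fin m, κ ℓ := by
  rw [term_zero_s13, ← mul_assoc, one_div, inv_mul_cancel₀ (by positivity), one_mul]
  refine add_le_of_nonpos_right (Finset.sum_nonpos ?_)
  rintro ⟨s, hs⟩ -
  refine mul_nonpos_of_nonneg_of_nonpos (hlam s hs) ?_
  have hs' := Finset.mem_Icc.mp hs
  match s, hs' with
  | 1, _ => exact term_one_s13 m b κ hκ Ω halt hskew hneg _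
  | r + 2, _ => exact (term_ge_two m b _ Ω hwedge r _).le
end
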